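/- The double-dualisation coercions are isomorphisms: suppose R̲ is either a computation-type constant or the type I̲. Then for every value type A, the closed EEC term ι_A : (Aᶜ)ᶜ → A is an isomorphism, i.e. there is a closed term ι_A⁻¹ : A → (Aᶜ)ᶜ with λx:A. ι_A(ι_A⁻¹ x) = λx:A. x and λx:(Aᶜ)ᶜ. ι_A⁻¹(ι_A x) = λx:(Aᶜ)ᶜ. x in the equational theory of EEC; and for every computation type A̲, the closed term ι_A̲ : (A̲ᶜ)ᶜ ⊸ A̲ is a linear isomorphism, i.e. there is a closed term ι_A̲⁻¹ : A̲ ⊸ (A̲ᶜ)ᶜ satisfying the analogous mutual-inverse equations. -/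

import Mathlib

set_option autoImplicit false

namespace EEC

/-! # The enriched effect calculus (EEC)

A deep embedding of the enriched effect calculus of Egger, Møgelberg and
Simpson: value types and computation types, raw terms (de Bruijn indices for
value variables, together with a designated stoup variable `svar`), typing
derivations with an (at most singleton) stoup, the βη-equational theory, the
simply-typed λ-calculus together with βη-equality and Moggi's computational
λ-calculus equality, the standard cbv/cbn translations of typed λ-calculus
into EEC, Hasegawa's linear-use CPS translations, and the generic linear-use
CPS self-translation of EEC. -/

mutual
  /-- Value types of EEC. -/
  inductive VType : Type
    | base : ℕ → VType                 -- value type constants α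
    | unit : VType                     -- 1
    | prod : VType → VType → VType     -- A × B
    | arr : VType → VType → VType      -- A → B
    | comp : CType → VType             -- every computation type is a value type
    | lin : CType → CType → VType      -- A̲ ⊸ B̲
  /-- Computation types of EEC. -/
  inductive CType : Type
    | base : ℕ → CType                 -- computation type constants α̲
    | cunit : CType                    -- 1̲
    | cand : CType → CType → CType     -- A̲ & B̲
    | carr : VType → CType → CType     -- A ⇒ B̲
    | iunit : CType                    -- I̲
    | bang : VType → CType             -- !A
    | copow : VType → CType → CType    -- !A ⊗ B̲
    | czero : CType                    -- 0̲
    | csum : CType → CType → CType     -- A̲ ⊕ B̲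
end

/-- Raw terms of EEC.  Value variables are de Bruijn indices (`var n`, with
`var 0` the innermost bound variable); the unique stoup variable is `svar`
(the constructs `llam`, `copowlet` (in its body) and `ccase` (in its
branches) bind the stoup variable). -/
inductive Tm : Type
  | var : ℕ → Tm                -- value variable
  | svar : Tm                   -- the stoup variable
  | unit : Tm                   -- * : 1
  | vpair : Tm → Tm → Tm        -- ⟨t,u⟩
  | vfst : Tm → Tm
  | vsnd : Tm → Tm
  | vlam : VType → Tm → Tm      -- λx:A. t
  | vapp : Tm → Tm → Tm
  | cunit : Tm                  -- ⋆ : 1̲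
  | cpair : Tm → Tm → Tm        -- ⟨t,u⟩ : A̲ & B̲
  | cfst : Tm → Tm
  | csnd : Tm → Tm
  | clam : VType → Tm → Tm      -- λx:A ⇒ t
  | capp : Tm → Tm → Tm         -- s ⋅ t
  | top : Tm                    -- ⊤ : I̲
  | ilet : Tm → Tm → Tm         -- t to ⊤. u
  | bang : Tm → Tm              -- !t
  | banglet : Tm → Tm → Tm      -- let !x = t in u   (binds a value variable in u)
  | copow : Tm → Tm → Tm        -- !t ⊗ u
  | copowlet : Tm → Tm → Tm     -- let !x⊗y = s in t (binds a value variable and the stoup variable in t)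
  | cimage : CType → Tm → Tm    -- image_{A̲}(t)
  | cinl : Tm → Tm
  | cinr : Tm → Tm
  | ccase : Tm → Tm → Tm → Tm   -- case s of (x. t | y. u)  (branches bind the stoup variable)
  | llam : CType → Tm → Tm      -- λ°z:A̲. t (binds the stoup variable)
  | lapp : Tm → Tm → Tm         -- s[t]

namespace Tm

/-- Lift a renaming of value variables under a binder. -/
def liftN (f : ℕ → ℕ) : ℕ → ℕ
  | 0 => 0
  | n + 1 => f n + 1

/-- Renaming of value variables. -/
def rename (f : ℕ → ℕ) : Tm → Tm
  | .var n => .var (f n)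
  | .svar => .svar
  | .unit => .unit
  | .vpair t u => .vpair (rename f t) (rename f u)
  | .vfst t => .vfst (rename f t)
  | .vsnd t => .vsnd (rename f t)
  | .vlam A t => .vlam A (rename (liftN f) t)
  | .vapp s t => .vapp (rename f s) (rename f t)
  | .cunit => .cunit
  | .cpair t u => .cpair (rename f t) (rename f u)
  | .cfst t => .cfst (rename f t)
  | .csnd t => .csnd (rename f t)
  | .clam A t => .clam A (rename (liftN f) t)
  | .capp s t => .capp (rename f s) (rename f t)
  | .top => .top
  | .ilet t u => .ilet (rename f t) (rename f u)
  | .bang t => .bang (rename f t)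
  | .banglet t u => .banglet (rename f t) (rename (liftN f) u)
  | .copow t u => .copow (rename f t) (rename f u)
  | .copowlet s t => .copowlet (rename f s) (rename (liftN f) t)
  | .cimage A t => .cimage A (rename f t)
  | .cinl t => .cinl (rename f t)
  | .cinr t => .cinr (rename f t)
  | .ccase s t u => .ccase (rename f s) (rename f t) (rename f u)
  | .llam A t => .llam A (rename f t)
  | .lapp s t => .lapp (rename f s) (rename f t)

/-- Weakening of value variables. -/
def shift (t : Tm) : Tm := rename Nat.succ t

/-- Lift a parallel substitution of value variables under a binder. -/
def liftS (σ : ℕ → Tm) : ℕ → Tm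
  | 0 => .var 0
  | n + 1 => shift (σ n)

/-- Parallel (capture-avoiding) substitution for value variables. -/
def psubst (σ : ℕ → Tm) : Tm → Tm
  | .var n => σ n
  | .svar => .svar
  | .unit => .unit
  | .vpair t u => .vpair (psubst σ t) (psubst σ u)
  | .vfst t => .vfst (psubst σ t)
  | .vsnd t => .vsnd (psubst σ t)
  | .vlam A t => .vlam A (psubst (liftS σ) t)
  | .vapp s t => .vapp (psubst σ s) (psubst σ t)
  | .cunit => .cunit
  | .cpair t u => .cpair (psubst σ t) (psubst σ u)
  | .cfst t => .cfst (psubst σ t)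
  | .csnd t => .csnd (psubst σ t)
  | .clam A t => .clam A (psubst (liftS σ) t)
  | .capp s t => .capp (psubst σ s) (psubst σ t)
  | .top => .top
  | .ilet t u => .ilet (psubst σ t) (psubst σ u)
  | .bang t => .bang (psubst σ t)
  | .banglet t u => .banglet (psubst σ t) (psubst (liftS σ) u)
  | .copow t u => .copow (psubst σ t) (psubst σ u)
  | .copowlet s t => .copowlet (psubst σ s) (psubst (liftS σ) t)
  | .cimage A t => .cimage A (psubst σ t)
  | .cinl t => .cinl (psubst σ t)
  | .cinr t => .cinr (psubst σ t)
  | .ccase s t u => .ccase (psubst σ s) (psubst σ t) (psubst σ u)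
  | .llam A t => .llam A (psubst σ t)
  | .lapp s t => .lapp (psubst σ s) (psubst σ t)

/-- Capture-avoiding substitution `t[u/x]` of a term `u` for the innermost
value variable of `t`. -/
def subst0 (u : Tm) (t : Tm) : Tm :=
  psubst (fun n => match n with | 0 => u | m + 1 => .var m) t

/-- Capture-avoiding substitution `t[u/z]` of a term `u` for the stoup
variable of `t`.  The substitution stops at the stoup-variable binders
(`llam`-bodies, `copowlet`-bodies and `ccase`-branches). -/
def ssubst (u : Tm) : Tm → Tm
  | .var n => .var n
  | .svar => u
  | .unit => .unit
  | .vpair t t' => .vpair (ssubst u t) (ssubst u t')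
  | .vfst t => .vfst (ssubst u t)
  | .vsnd t => .vsnd (ssubst u t)
  | .vlam A t => .vlam A (ssubst (shift u) t)
  | .vapp s t => .vapp (ssubst u s) (ssubst u t)
  | .cunit => .cunit
  | .cpair t t' => .cpair (ssubst u t) (ssubst u t')
  | .cfst t => .cfst (ssubst u t)
  | .csnd t => .csnd (ssubst u t)
  | .clam A t => .clam A (ssubst (shift u) t)
  | .capp s t => .capp (ssubst u s) (ssubst u t)
  | .top => .top
  | .ilet t t' => .ilet (ssubst u t) (ssubst u t')
  | .bang t => .bang (ssubst u t)
  | .banglet t t' => .banglet (ssubst u t) (ssubst (shift u) t')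
  | .copow t t' => .copow (ssubst u t) (ssubst u t')
  | .copowlet s t => .copowlet (ssubst u s) t
  | .cimage A t => .cimage A (ssubst u t)
  | .cinl t => .cinl (ssubst u t)
  | .cinr t => .cinr (ssubst u t)
  | .ccase s t t' => .ccase (ssubst u s) t t'
  | .llam A t => .llam A t
  | .lapp s t => .lapp (ssubst u s) (ssubst u t)

end Tm

/-- Typing derivations of EEC (Figure 1 of the paper).  `Deriv Γ none t A`
is the judgement `Γ ⊢ t : A` (empty stoup); `Deriv Γ (some A̲) t (.comp B̲)`
is the judgement `Γ | z:A̲ ⊢ t : B̲`.  In the rules below `Δ` ranges over an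
arbitrary (possibly empty) stoup. -/
inductive Deriv : List VType → Option CType → Tm → VType → Type
  | var (Γ : List VType) (n : ℕ) (A : VType) :
      Γ[n]? = some A → Deriv Γ none (.var n) A
  | svar (Γ : List VType) (A : CType) : Deriv Γ (some A) .svar (.comp A)
  | unit (Γ : List VType) : Deriv Γ none .unit .unit
  | vpair (Γ : List VType) (t u : Tm) (A B : VType) :
      Deriv Γ none t A → Deriv Γ none u B → Deriv Γ none (.vpair t u) (.prod A B)
  | vfst (Γ : List VType) (t : Tm) (A B : VType) :
      Deriv Γ none t (.prod A B) → Deriv Γ none (.vfst t) A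
  | vsnd (Γ : List VType) (t : Tm) (A B : VType) :
      Deriv Γ none t (.prod A B) → Deriv Γ none (.vsnd t) B
  | vlam (Γ : List VType) (t : Tm) (A B : VType) :
      Deriv (A :: Γ) none t B → Deriv Γ none (.vlam A t) (.arr A B)
  | vapp (Γ : List VType) (s t : Tm) (A B : VType) :
      Deriv Γ none s (.arr A B) → Deriv Γ none t A → Deriv Γ none (.vapp s t) B
  | cunit (Γ : List VType) (Δ : Option CType) : Deriv Γ Δ .cunit (.comp .cunit)
  | cpair (Γ : List VType) (Δ : Option CType) (t u : Tm) (A B : CType) :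
      Deriv Γ Δ t (.comp A) → Deriv Γ Δ u (.comp B) →
      Deriv Γ Δ (.cpair t u) (.comp (.cand A B))
  | cfst (Γ : List VType) (Δ : Option CType) (t : Tm) (A B : CType) :
      Deriv Γ Δ t (.comp (.cand A B)) → Deriv Γ Δ (.cfst t) (.comp A)
  | csnd (Γ : List VType) (Δ : Option CType) (t : Tm) (A B : CType) :
      Deriv Γ Δ t (.comp (.cand A B)) → Deriv Γ Δ (.csnd t) (.comp B)
  | clam (Γ : List VType) (Δ : Option CType) (t : Tm) (A : VType) (B : CType) :
      Deriv (A :: Γ) Δ t (.comp B) → Deriv Γ Δ (.clam A t) (.comp (.carr A B))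
  | capp (Γ : List VType) (Δ : Option CType) (s t : Tm) (A : VType) (B : CType) :
      Deriv Γ Δ s (.comp (.carr A B)) → Deriv Γ none t A →
      Deriv Γ Δ (.capp s t) (.comp B)
  | top (Γ : List VType) : Deriv Γ none .top (.comp .iunit)
  | ilet (Γ : List VType) (Δ : Option CType) (t u : Tm) (A : CType) :
      Deriv Γ Δ t (.comp .iunit) → Deriv Γ none u (.comp A) →
      Deriv Γ Δ (.ilet t u) (.comp A)
  | bang (Γ : List VType) (t : Tm) (A : VType) :
      Deriv Γ none t A → Deriv Γ none (.bang t) (.comp (.bang A))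
  | banglet (Γ : List VType) (Δ : Option CType) (t u : Tm) (A : VType) (B : CType) :
      Deriv Γ Δ t (.comp (.bang A)) → Deriv (A :: Γ) none u (.comp B) →
      Deriv Γ Δ (.banglet t u) (.comp B)
  | copow (Γ : List VType) (Δ : Option CType) (t u : Tm) (A : VType) (B : CType) :
      Deriv Γ none t A → Deriv Γ Δ u (.comp B) →
      Deriv Γ Δ (.copow t u) (.comp (.copow A B))
  | copowlet (Γ : List VType) (Δ : Option CType) (s t : Tm) (A : VType) (B C : CType) :
      Deriv Γ Δ s (.comp (.copow A B)) → Deriv (A :: Γ) (some B) t (.comp C) →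
      Deriv Γ Δ (.copowlet s t) (.comp C)
  | cimage (Γ : List VType) (Δ : Option CType) (t : Tm) (A : CType) :
      Deriv Γ Δ t (.comp .czero) → Deriv Γ Δ (.cimage A t) (.comp A)
  | cinl (Γ : List VType) (Δ : Option CType) (t : Tm) (A B : CType) :
      Deriv Γ Δ t (.comp A) → Deriv Γ Δ (.cinl t) (.comp (.csum A B))
  | cinr (Γ : List VType) (Δ : Option CType) (t : Tm) (A B : CType) :
      Deriv Γ Δ t (.comp B) → Deriv Γ Δ (.cinr t) (.comp (.csum A B))
  | ccase (Γ : List VType) (Δ : Option CType) (s t u : Tm) (A B C : CType) :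
      Deriv Γ Δ s (.comp (.csum A B)) → Deriv Γ (some A) t (.comp C) →
      Deriv Γ (some B) u (.comp C) → Deriv Γ Δ (.ccase s t u) (.comp C)
  | llam (Γ : List VType) (t : Tm) (A B : CType) :
      Deriv Γ (some A) t (.comp B) → Deriv Γ none (.llam A t) (.lin A B)
  | lapp (Γ : List VType) (Δ : Option CType) (s t : Tm) (A B : CType) :
      Deriv Γ none s (.lin A B) → Deriv Γ Δ t (.comp A) →
      Deriv Γ Δ (.lapp s t) (.comp B)

/-- The equational theory of EEC: the smallest type-respecting congruence
containing the βη-equalities of Figure 2 of the paper. -/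
inductive EEq : List VType → Option CType → Tm → Tm → VType → Prop
  -- equivalence
  | refl {Γ Δ t A} : Deriv Γ Δ t A → EEq Γ Δ t t A
  | symm {Γ Δ t u A} : EEq Γ Δ t u A → EEq Γ Δ u t A
  | trans {Γ Δ t u v A} : EEq Γ Δ t u A → EEq Γ Δ u v A → EEq Γ Δ t v A
  -- congruence rules
  | vpair_cong {Γ t t' u u' A B} : EEq Γ none t t' A → EEq Γ none u u' B →
      EEq Γ none (.vpair t u) (.vpair t' u') (.prod A B)
  | vfst_cong {Γ t t' A B} : EEq Γ none t t' (.prod A B) →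
      EEq Γ none (.vfst t) (.vfst t') A
  | vsnd_cong {Γ t t' A B} : EEq Γ none t t' (.prod A B) →
      EEq Γ none (.vsnd t) (.vsnd t') B
  | vlam_cong {Γ t t' A B} : EEq (A :: Γ) none t t' B →
      EEq Γ none (.vlam A t) (.vlam A t') (.arr A B)
  | vapp_cong {Γ s s' t t' A B} : EEq Γ none s s' (.arr A B) → EEq Γ none t t' A →
      EEq Γ none (.vapp s t) (.vapp s' t') B
  | cpair_cong {Γ Δ t t' u u' A B} : EEq Γ Δ t t' (.comp A) → EEq Γ Δ u u' (.comp B) →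
      EEq Γ Δ (.cpair t u) (.cpair t' u') (.comp (.cand A B))
  | cfst_cong {Γ Δ t t' A B} : EEq Γ Δ t t' (.comp (.cand A B)) →
      EEq Γ Δ (.cfst t) (.cfst t') (.comp A)
  | csnd_cong {Γ Δ t t' A B} : EEq Γ Δ t t' (.comp (.cand A B)) →
      EEq Γ Δ (.csnd t) (.csnd t') (.comp B)
  | clam_cong {Γ Δ t t' A B} : EEq (A :: Γ) Δ t t' (.comp B) →
      EEq Γ Δ (.clam A t) (.clam A t') (.comp (.carr A B))
  | capp_cong {Γ Δ s s' t t' A B} : EEq Γ Δ s s' (.comp (.carr A B)) → EEq Γ none t t' A →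
      EEq Γ Δ (.capp s t) (.capp s' t') (.comp B)
  | ilet_cong {Γ Δ t t' u u' A} : EEq Γ Δ t t' (.comp .iunit) → EEq Γ none u u' (.comp A) →
      EEq Γ Δ (.ilet t u) (.ilet t' u') (.comp A)
  | bang_cong {Γ t t' A} : EEq Γ none t t' A →
      EEq Γ none (.bang t) (.bang t') (.comp (.bang A))
  | banglet_cong {Γ Δ t t' u u' A B} : EEq Γ Δ t t' (.comp (.bang A)) →
      EEq (A :: Γ) none u u' (.comp B) →
      EEq Γ Δ (.banglet t u) (.banglet t' u') (.comp B)
  | copow_cong {Γ Δ t t' u u' A B} : EEq Γ none t t' A → EEq Γ Δ u u' (.comp B) →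
      EEq Γ Δ (.copow t u) (.copow t' u') (.comp (.copow A B))
  | copowlet_cong {Γ Δ s s' t t' A B C} : EEq Γ Δ s s' (.comp (.copow A B)) →
      EEq (A :: Γ) (some B) t t' (.comp C) →
      EEq Γ Δ (.copowlet s t) (.copowlet s' t') (.comp C)
  | cimage_cong {Γ Δ t t' A} : EEq Γ Δ t t' (.comp .czero) →
      EEq Γ Δ (.cimage A t) (.cimage A t') (.comp A)
  | cinl_cong {Γ Δ t t' A B} : EEq Γ Δ t t' (.comp A) →
      EEq Γ Δ (.cinl t) (.cinl t') (.comp (.csum A B))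
  | cinr_cong {Γ Δ t t' A B} : EEq Γ Δ t t' (.comp B) →
      EEq Γ Δ (.cinr t) (.cinr t') (.comp (.csum A B))
  | ccase_cong {Γ Δ s s' t t' u u' A B C} : EEq Γ Δ s s' (.comp (.csum A B)) →
      EEq Γ (some A) t t' (.comp C) → EEq Γ (some B) u u' (.comp C) →
      EEq Γ Δ (.ccase s t u) (.ccase s' t' u') (.comp C)
  | llam_cong {Γ t t' A B} : EEq Γ (some A) t t' (.comp B) →
      EEq Γ none (.llam A t) (.llam A t') (.lin A B)
  | lapp_cong {Γ Δ s s' t t' A B} : EEq Γ none s s' (.lin A B) → EEq Γ Δ t t' (.comp A) →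
      EEq Γ Δ (.lapp s t) (.lapp s' t') (.comp B)
  -- the equalities of Figure 2
  | unit_eta {Γ t} : Deriv Γ none t .unit → EEq Γ none t .unit .unit
  | vfst_beta {Γ t u A B} : Deriv Γ none t A → Deriv Γ none u B →
      EEq Γ none (.vfst (.vpair t u)) t A
  | vsnd_beta {Γ t u A B} : Deriv Γ none t A → Deriv Γ none u B →
      EEq Γ none (.vsnd (.vpair t u)) u B
  | vpair_eta {Γ t A B} : Deriv Γ none t (.prod A B) →
      EEq Γ none (.vpair (.vfst t) (.vsnd t)) t (.prod A B)
  | vlam_beta {Γ t u A B} : Deriv (A :: Γ) none t B → Deriv Γ none u A →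
      EEq Γ none (.vapp (.vlam A t) u) (Tm.subst0 u t) B
  | vlam_eta {Γ t A B} : Deriv Γ none t (.arr A B) →
      EEq Γ none (.vlam A (.vapp (Tm.shift t) (.var 0))) t (.arr A B)
  | cunit_eta {Γ Δ t} : Deriv Γ Δ t (.comp .cunit) → EEq Γ Δ t .cunit (.comp .cunit)
  | cfst_beta {Γ Δ t u A B} : Deriv Γ Δ t (.comp A) → Deriv Γ Δ u (.comp B) →
      EEq Γ Δ (.cfst (.cpair t u)) t (.comp A)
  | csnd_beta {Γ Δ t u A B} : Deriv Γ Δ t (.comp A) → Deriv Γ Δ u (.comp B) →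
      EEq Γ Δ (.csnd (.cpair t u)) u (.comp B)
  | cpair_eta {Γ Δ t A B} : Deriv Γ Δ t (.comp (.cand A B)) →
      EEq Γ Δ (.cpair (.cfst t) (.csnd t)) t (.comp (.cand A B))
  | clam_beta {Γ Δ t u A B} : Deriv (A :: Γ) Δ t (.comp B) → Deriv Γ none u A →
      EEq Γ Δ (.capp (.clam A t) u) (Tm.subst0 u t) (.comp B)
  | clam_eta {Γ Δ t A B} : Deriv Γ Δ t (.comp (.carr A B)) →
      EEq Γ Δ (.clam A (.capp (Tm.shift t) (.var 0))) t (.comp (.carr A B))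
  | ilet_beta {Γ t A} : Deriv Γ none t (.comp A) →
      EEq Γ none (.ilet .top t) t (.comp A)
  | ilet_eta {Γ Δ t u A} : Deriv Γ Δ t (.comp .iunit) → Deriv Γ (some .iunit) u (.comp A) →
      EEq Γ Δ (.ilet t (Tm.ssubst .top u)) (Tm.ssubst t u) (.comp A)
  | bang_beta {Γ t u A B} : Deriv Γ none t A → Deriv (A :: Γ) none u (.comp B) →
      EEq Γ none (.banglet (.bang t) u) (Tm.subst0 t u) (.comp B)
  | bang_eta {Γ Δ t u A B} : Deriv Γ Δ t (.comp (.bang A)) →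
      Deriv Γ (some (.bang A)) u (.comp B) →
      EEq Γ Δ (.banglet t (Tm.ssubst (.bang (.var 0)) (Tm.shift u))) (Tm.ssubst t u) (.comp B)
  | copow_beta {Γ Δ t s u A B C} : Deriv Γ none t A → Deriv Γ Δ s (.comp B) →
      Deriv (A :: Γ) (some B) u (.comp C) →
      EEq Γ Δ (.copowlet (.copow t s) u) (Tm.ssubst s (Tm.subst0 t u)) (.comp C)
  | copow_eta {Γ Δ t u A B C} : Deriv Γ Δ t (.comp (.copow A B)) →
      Deriv Γ (some (.copow A B)) u (.comp C) →
      EEq Γ Δ (.copowlet t (Tm.ssubst (.copow (.var 0) .svar) (Tm.shift u))) (Tm.ssubst t u) (.comp C)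
  | czero_eta {Γ Δ t u A} : Deriv Γ Δ t (.comp .czero) → Deriv Γ (some .czero) u (.comp A) →
      EEq Γ Δ (.cimage A t) (Tm.ssubst t u) (.comp A)
  | csum_beta_inl {Γ Δ t u u' A B C} : Deriv Γ (some A) u (.comp C) →
      Deriv Γ (some B) u' (.comp C) → Deriv Γ Δ t (.comp A) →
      EEq Γ Δ (.ccase (.cinl t) u u') (Tm.ssubst t u) (.comp C)
  | csum_beta_inr {Γ Δ t u u' A B C} : Deriv Γ (some A) u (.comp C) →
      Deriv Γ (some B) u' (.comp C) → Deriv Γ Δ t (.comp B) →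
      EEq Γ Δ (.ccase (.cinr t) u u') (Tm.ssubst t u') (.comp C)
  | csum_eta {Γ Δ t u A B C} : Deriv Γ Δ t (.comp (.csum A B)) →
      Deriv Γ (some (.csum A B)) u (.comp C) →
      EEq Γ Δ (.ccase t (Tm.ssubst (.cinl .svar) u) (Tm.ssubst (.cinr .svar) u)) (Tm.ssubst t u) (.comp C)
  | llam_beta {Γ Δ t u A B} : Deriv Γ (some A) t (.comp B) → Deriv Γ Δ u (.comp A) →
      EEq Γ Δ (.lapp (.llam A t) u) (Tm.ssubst u t) (.comp B)
  | llam_eta {Γ t A B} : Deriv Γ none t (.lin A B) →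
      EEq Γ none (.llam A (.lapp t .svar)) t (.lin A B)

end EEC

namespace EEC

/-! ## The generic linear-use CPS self-translation of EEC (Figures 4–6) -/

mutual
  /-- CPS translation `Aᶜ` of value types, relative to the result type `R̲`. -/
  def cpsV (R : CType) : VType → VType
    | .base a => .base a
    | .unit => .unit
    | .prod A B => .prod (cpsV R A) (cpsV R B)
    | .arr A B => .arr (cpsV R A) (cpsV R B)
    | .comp A => .lin (cpsC R A) R
    | .lin A B => .lin (cpsC R B) (cpsC R A)
  /-- CPS translation `A̲ᶜ` of computation types, relative to the result type
  `R̲` (a computation-type constant equal to `R̲` is translated to `I̲`). -/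
  def cpsC (R : CType) : CType → CType
    | .base a =>
        match R with
        | .base b => if b = a then .iunit else .base a
        | _ => .base a
    | .cunit => .czero
    | .cand A B => .csum (cpsC R A) (cpsC R B)
    | .carr A B => .copow (cpsV R A) (cpsC R B)
    | .iunit => R
    | .bang A => .carr (cpsV R A) R
    | .copow A B => .carr (cpsV R A) (cpsC R B)
    | .czero => .cunit
    | .csum A B => .cand (cpsC R A) (cpsC R B)
end

/-- Pointwise CPS translation `Γᶜ` of a context. -/
def cpsCtx (R : CType) (Γ : List VType) : List VType := Γ.map (cpsV R)

/-- The generic linear-use CPS self-translation on terms (Figures 5 and 6 of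
the paper), defined by recursion on typing derivations.  A value judgement
`Γ ⊢ t : A` is sent to a term `tᶜ` with `Γᶜ ⊢ tᶜ : Aᶜ`, and a stoup
judgement `Γ | z:A̲ ⊢ t : B̲` is sent (contravariantly) to a term `tᶜ` with
`Γᶜ | k_z:B̲ᶜ ⊢ tᶜ : A̲ᶜ`. -/
def cps (R : CType) : {Γ : List VType} → {Δ : Option CType} → {t : Tm} → {A : VType} →
    Deriv Γ Δ t A → Tm
  | _, _, _, _, .var _ n _ _ => .var n
  | _, _, _, _, .svar _ _ => .svar
  | _, _, _, _, .unit _ => .unit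
  | _, _, _, _, .vpair _ _ _ _ _ d1 d2 => .vpair (cps R d1) (cps R d2)
  | _, _, _, _, .vfst _ _ _ _ d => .vfst (cps R d)
  | _, _, _, _, .vsnd _ _ _ _ d => .vsnd (cps R d)
  | _, _, _, _, .vlam _ _ A _ d => .vlam (cpsV R A) (cps R d)
  | _, _, _, _, .vapp _ _ _ _ _ d1 d2 => .vapp (cps R d1) (cps R d2)
  | _, _, _, _, .cunit _ none => .llam .czero (.cimage R .svar)
  | _, _, _, _, .cunit _ (some D) => .cimage (cpsC R D) .svar
  | _, _, _, _, .cpair _ none _ _ A B d1 d2 =>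
      .llam (.csum (cpsC R A) (cpsC R B))
        (.ccase .svar (.lapp (cps R d1) .svar) (.lapp (cps R d2) .svar))
  | _, _, _, _, .cpair _ (some _) _ _ _ _ d1 d2 => .ccase .svar (cps R d1) (cps R d2)
  | _, _, _, _, .cfst _ none _ A _ d => .llam (cpsC R A) (.lapp (cps R d) (.cinl .svar))
  | _, _, _, _, .cfst _ (some _) _ _ _ d => Tm.ssubst (.cinl .svar) (cps R d)
  | _, _, _, _, .csnd _ none _ _ B d => .llam (cpsC R B) (.lapp (cps R d) (.cinr .svar))
  | _, _, _, _, .csnd _ (some _) _ _ _ d => Tm.ssubst (.cinr .svar) (cps R d)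
  | _, _, _, _, .clam _ none _ A B d =>
      .llam (.copow (cpsV R A) (cpsC R B)) (.copowlet .svar (.lapp (cps R d) .svar))
  | _, _, _, _, .clam _ (some _) _ _ _ d => .copowlet .svar (cps R d)
  | _, _, _, _, .capp _ none _ _ _ B d1 d2 =>
      .llam (cpsC R B) (.lapp (cps R d1) (.copow (cps R d2) .svar))
  | _, _, _, _, .capp _ (some _) _ _ _ _ d1 d2 =>
      Tm.ssubst (.copow (cps R d2) .svar) (cps R d1)
  | _, _, _, _, .top _ => .llam R .svar
  | _, _, _, _, .ilet _ none _ _ A d1 d2 =>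
      .llam (cpsC R A) (.lapp (cps R d1) (.lapp (cps R d2) .svar))
  | _, _, _, _, .ilet _ (some _) _ _ _ d1 d2 =>
      Tm.ssubst (.lapp (cps R d2) .svar) (cps R d1)
  | _, _, _, _, .bang _ _ A d => .llam (.carr (cpsV R A) R) (.capp .svar (cps R d))
  | _, _, _, _, .banglet _ none _ _ A B d1 d2 =>
      .llam (cpsC R B) (.lapp (cps R d1) (.clam (cpsV R A) (.lapp (cps R d2) .svar)))
  | _, _, _, _, .banglet _ (some _) _ _ A _ d1 d2 =>
      Tm.ssubst (.clam (cpsV R A) (.lapp (cps R d2) .svar)) (cps R d1)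
  | _, _, _, _, .copow _ none _ _ A B d1 d2 =>
      .llam (.carr (cpsV R A) (cpsC R B)) (.lapp (cps R d2) (.capp .svar (cps R d1)))
  | _, _, _, _, .copow _ (some _) _ _ _ _ d1 d2 =>
      Tm.ssubst (.capp .svar (cps R d1)) (cps R d2)
  | _, _, _, _, .copowlet _ none _ _ A _ C d1 d2 =>
      .llam (cpsC R C) (.lapp (cps R d1) (.clam (cpsV R A) (cps R d2)))
  | _, _, _, _, .copowlet _ (some _) _ _ A _ _ d1 d2 =>
      Tm.ssubst (.clam (cpsV R A) (cps R d2)) (cps R d1)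
  | _, _, _, _, .cimage _ none _ A d => .llam (cpsC R A) (.lapp (cps R d) .cunit)
  | _, _, _, _, .cimage _ (some _) _ _ d => Tm.ssubst .cunit (cps R d)
  | _, _, _, _, .cinl _ none _ A B d =>
      .llam (.cand (cpsC R A) (cpsC R B)) (.lapp (cps R d) (.cfst .svar))
  | _, _, _, _, .cinl _ (some _) _ _ _ d => Tm.ssubst (.cfst .svar) (cps R d)
  | _, _, _, _, .cinr _ none _ A B d =>
      .llam (.cand (cpsC R A) (cpsC R B)) (.lapp (cps R d) (.csnd .svar))
  | _, _, _, _, .cinr _ (some _) _ _ _ d => Tm.ssubst (.csnd .svar) (cps R d)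
  | _, _, _, _, .ccase _ none _ _ _ _ _ C d1 d2 d3 =>
      .llam (cpsC R C) (.lapp (cps R d1) (.cpair (cps R d2) (cps R d3)))
  | _, _, _, _, .ccase _ (some _) _ _ _ _ _ _ d1 d2 d3 =>
      Tm.ssubst (.cpair (cps R d2) (cps R d3)) (cps R d1)
  | _, _, _, _, .llam _ _ _ B d => .llam (cpsC R B) (cps R d)
  | _, _, _, _, .lapp _ none _ _ _ B d1 d2 =>
      .llam (cpsC R B) (.lapp (cps R d2) (.lapp (cps R d1) .svar))
  | _, _, _, _, .lapp _ (some _) _ _ _ _ d1 d2 =>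
      Tm.ssubst (.lapp (cps R d1) .svar) (cps R d2)

end EEC

namespace EEC

/-! ## The type isomorphisms `ι` of Figure 7, with explicit inverses -/

mutual
  /-- The closed term `ι_A : (Aᶜ)ᶜ → A` (Figure 7). -/
  def iotaV (R : CType) : VType → Tm
    | .base a => .vlam (.base a) (.var 0)
    | .unit => .vlam .unit .unit
    | .prod A B => .vlam (cpsV R (cpsV R (.prod A B)))
        (.vpair (.vapp (iotaV R A) (.vfst (.var 0))) (.vapp (iotaV R B) (.vsnd (.var 0))))
    | .arr A B => .vlam (cpsV R (cpsV R (.arr A B)))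
        (.vlam A (.vapp (iotaV R B) (.vapp (.var 1) (.vapp (iotaVinv R A) (.var 0)))))
    | .comp A => .vlam (cpsV R (cpsV R (.comp A)))
        (.lapp (iotaC R A) (.lapp (.var 0) .top))
    | .lin A B => .vlam (cpsV R (cpsV R (.lin A B)))
        (.llam A (.lapp (iotaC R B) (.lapp (.var 0) (.lapp (iotaCinv R A) .svar))))
  /-- The closed term `ι_A⁻¹ : A → (Aᶜ)ᶜ`. -/
  def iotaVinv (R : CType) : VType → Tm
    | .base a => .vlam (.base a) (.var 0)
    | .unit => .vlam .unit .unit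
    | .prod A B => .vlam (.prod A B)
        (.vpair (.vapp (iotaVinv R A) (.vfst (.var 0))) (.vapp (iotaVinv R B) (.vsnd (.var 0))))
    | .arr A B => .vlam (.arr A B)
        (.vlam (cpsV R (cpsV R A)) (.vapp (iotaVinv R B) (.vapp (.var 1) (.vapp (iotaV R A) (.var 0)))))
    | .comp A => .vlam (.comp A)
        (.llam .iunit (.ilet .svar (.lapp (iotaCinv R A) (.var 0))))
    | .lin A B => .vlam (.lin A B)
        (.llam (cpsC R (cpsC R A)) (.lapp (iotaCinv R B) (.lapp (.var 0) (.lapp (iotaC R A) .svar))))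
  /-- The closed term `ι_A̲ : (A̲ᶜ)ᶜ ⊸ A̲` (Figure 7). -/
  def iotaC (R : CType) : CType → Tm
    | .base a => .llam (cpsC R (cpsC R (.base a))) .svar
    | .cunit => .llam (cpsC R (cpsC R .cunit)) .cunit
    | .cand A B => .llam (cpsC R (cpsC R (.cand A B)))
        (.cpair (.lapp (iotaC R A) (.cfst .svar)) (.lapp (iotaC R B) (.csnd .svar)))
    | .carr A B => .llam (cpsC R (cpsC R (.carr A B)))
        (.clam A (.lapp (iotaC R B) (.capp .svar (.vapp (iotaVinv R A) (.var 0)))))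
    | .iunit => .llam (cpsC R (cpsC R .iunit)) .svar
    | .bang A => .llam (cpsC R (cpsC R (.bang A)))
        (.copowlet .svar (.ilet .svar (.bang (.vapp (iotaV R A) (.var 0)))))
    | .copow A B => .llam (cpsC R (cpsC R (.copow A B)))
        (.copowlet .svar (.copow (.vapp (iotaV R A) (.var 0)) (.lapp (iotaC R B) .svar)))
    | .czero => .llam (cpsC R (cpsC R .czero)) .svar
    | .csum A B => .llam (cpsC R (cpsC R (.csum A B)))
        (.ccase .svar (.cinl (.lapp (iotaC R A) .svar)) (.cinr (.lapp (iotaC R B) .svar)))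
  /-- The closed term `ι_A̲⁻¹ : A̲ ⊸ (A̲ᶜ)ᶜ`. -/
  def iotaCinv (R : CType) : CType → Tm
    | .base a => .llam (.base a) .svar
    | .cunit => .llam .cunit .cunit
    | .cand A B => .llam (.cand A B)
        (.cpair (.lapp (iotaCinv R A) (.cfst .svar)) (.lapp (iotaCinv R B) (.csnd .svar)))
    | .carr A B => .llam (.carr A B)
        (.clam (cpsV R (cpsV R A)) (.lapp (iotaCinv R B) (.capp .svar (.vapp (iotaV R A) (.var 0)))))
    | .iunit => .llam .iunit .svar
    | .bang A => .llam (.bang A)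
        (.banglet .svar (.copow (.vapp (iotaVinv R A) (.var 0)) .top))
    | .copow A B => .llam (.copow A B)
        (.copowlet .svar (.copow (.vapp (iotaVinv R A) (.var 0)) (.lapp (iotaCinv R B) .svar)))
    | .czero => .llam .czero .svar
    | .csum A B => .llam (.csum A B)
        (.ccase .svar (.cinl (.lapp (iotaCinv R A) .svar)) (.cinr (.lapp (iotaCinv R B) .svar)))
end

/-- The substitution `[ι⁻¹(Γ)]`, replacing each variable `xᵢ : Cᵢ` of `Γ` by
`ι_{Cᵢ}⁻¹(xᵢ)`. -/
def iotaSubst (R : CType) (Γ : List VType) (t : Tm) : Tm :=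
  Tm.psubst (fun n =>
    match Γ[n]? with
    | some C => .vapp (iotaVinv R C) (.var n)
    | none => .var n) t

/-! ## The simply-typed λ-calculus -/

/-- Simple types. -/
inductive STy : Type
  | base : ℕ → STy
  | unit : STy
  | prod : STy → STy → STy
  | arr : STy → STy → STy

/-- Raw simply-typed λ-terms (de Bruijn indices). -/
inductive LTm : Type
  | var : ℕ → LTm
  | unit : LTm
  | pair : LTm → LTm → LTm
  | fst : LTm → LTm
  | snd : LTm → LTm
  | lam : STy → LTm → LTm
  | app : LTm → LTm → LTm

namespace LTm

/-- Renaming of variables. -/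
def rename (f : ℕ → ℕ) : LTm → LTm
  | .var n => .var (f n)
  | .unit => .unit
  | .pair M N => .pair (rename f M) (rename f N)
  | .fst M => .fst (rename f M)
  | .snd M => .snd (rename f M)
  | .lam σ M => .lam σ (rename (Tm.liftN f) M)
  | .app M N => .app (rename f M) (rename f N)

/-- Weakening. -/
def shift (M : LTm) : LTm := rename Nat.succ M

/-- Parallel capture-avoiding substitution. -/
def psubst (σ : ℕ → LTm) : LTm → LTm
  | .var n => σ n
  | .unit => .unit
  | .pair M N => .pair (psubst σ M) (psubst σ N)
  | .fst M => .fst (psubst σ M)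
  | .snd M => .snd (psubst σ M)
  | .lam τ M => .lam τ (psubst (fun n => match n with | 0 => .var 0 | m + 1 => shift (σ m)) M)
  | .app M N => .app (psubst σ M) (psubst σ N)

/-- Capture-avoiding substitution `M[N/x]` for the innermost variable. -/
def subst0 (N : LTm) (M : LTm) : LTm :=
  psubst (fun n => match n with | 0 => N | m + 1 => .var m) M

end LTm

/-- Typing derivations of the simply-typed λ-calculus (Figure 3). -/
inductive LDeriv : List STy → LTm → STy → Type
  | var (Θ : List STy) (n : ℕ) (σ : STy) : Θ[n]? = some σ → LDeriv Θ (.var n) σ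
  | unit (Θ : List STy) : LDeriv Θ .unit .unit
  | pair (Θ : List STy) (M N : LTm) (σ τ : STy) :
      LDeriv Θ M σ → LDeriv Θ N τ → LDeriv Θ (.pair M N) (.prod σ τ)
  | fst (Θ : List STy) (M : LTm) (σ τ : STy) :
      LDeriv Θ M (.prod σ τ) → LDeriv Θ (.fst M) σ
  | snd (Θ : List STy) (M : LTm) (σ τ : STy) :
      LDeriv Θ M (.prod σ τ) → LDeriv Θ (.snd M) τ
  | lam (Θ : List STy) (M : LTm) (σ τ : STy) :
      LDeriv (σ :: Θ) M τ → LDeriv Θ (.lam σ M) (.arr σ τ)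
  | app (Θ : List STy) (M N : LTm) (σ τ : STy) :
      LDeriv Θ M (.arr σ τ) → LDeriv Θ N σ → LDeriv Θ (.app M N) τ

/-- Values of the (call-by-value) λ-calculus. -/
inductive LVal : LTm → Prop
  | var (n : ℕ) : LVal (.var n)
  | unit : LVal .unit
  | lam (σ : STy) (M : LTm) : LVal (.lam σ M)
  | pair {M N : LTm} : LVal M → LVal N → LVal (.pair M N)

/-- βη-equality of the simply-typed λ-calculus. -/
inductive LBetaEta : List STy → LTm → LTm → STy → Prop
  | refl {Θ M σ} : LDeriv Θ M σ → LBetaEta Θ M M σ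
  | symm {Θ M N σ} : LBetaEta Θ M N σ → LBetaEta Θ N M σ
  | trans {Θ M N P σ} : LBetaEta Θ M N σ → LBetaEta Θ N P σ → LBetaEta Θ M P σ
  | pair_cong {Θ M M' N N' σ τ} : LBetaEta Θ M M' σ → LBetaEta Θ N N' τ →
      LBetaEta Θ (.pair M N) (.pair M' N') (.prod σ τ)
  | fst_cong {Θ M M' σ τ} : LBetaEta Θ M M' (.prod σ τ) → LBetaEta Θ (.fst M) (.fst M') σ
  | snd_cong {Θ M M' σ τ} : LBetaEta Θ M M' (.prod σ τ) → LBetaEta Θ (.snd M) (.snd M') τ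
  | lam_cong {Θ M M' σ τ} : LBetaEta (σ :: Θ) M M' τ →
      LBetaEta Θ (.lam σ M) (.lam σ M') (.arr σ τ)
  | app_cong {Θ M M' N N' σ τ} : LBetaEta Θ M M' (.arr σ τ) → LBetaEta Θ N N' σ →
      LBetaEta Θ (.app M N) (.app M' N') τ
  | beta {Θ M N σ τ} : LDeriv (σ :: Θ) M τ → LDeriv Θ N σ →
      LBetaEta Θ (.app (.lam σ M) N) (LTm.subst0 N M) τ
  | eta {Θ M σ τ} : LDeriv Θ M (.arr σ τ) →
      LBetaEta Θ (.lam σ (.app (LTm.shift M) (.var 0))) M (.arr σ τ)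
  | fst_beta {Θ M N σ τ} : LDeriv Θ M σ → LDeriv Θ N τ →
      LBetaEta Θ (.fst (.pair M N)) M σ
  | snd_beta {Θ M N σ τ} : LDeriv Θ M σ → LDeriv Θ N τ →
      LBetaEta Θ (.snd (.pair M N)) N τ
  | pair_eta {Θ M σ τ} : LDeriv Θ M (.prod σ τ) →
      LBetaEta Θ (.pair (.fst M) (.snd M)) M (.prod σ τ)
  | unit_eta {Θ M} : LDeriv Θ M .unit → LBetaEta Θ M .unit .unit

/-- Equality in Moggi's computational λ-calculus `λc` (call-by-value
βη-equalities restricted to values, together with the `let`-laws, expressed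
via the standard encoding `let x = M in N := (λx.N) M`). -/
inductive LamC : List STy → LTm → LTm → STy → Prop
  | refl {Θ M σ} : LDeriv Θ M σ → LamC Θ M M σ
  | symm {Θ M N σ} : LamC Θ M N σ → LamC Θ N M σ
  | trans {Θ M N P σ} : LamC Θ M N σ → LamC Θ N P σ → LamC Θ M P σ
  | pair_cong {Θ M M' N N' σ τ} : LamC Θ M M' σ → LamC Θ N N' τ →
      LamC Θ (.pair M N) (.pair M' N') (.prod σ τ)
  | fst_cong {Θ M M' σ τ} : LamC Θ M M' (.prod σ τ) → LamC Θ (.fst M) (.fst M') σ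
  | snd_cong {Θ M M' σ τ} : LamC Θ M M' (.prod σ τ) → LamC Θ (.snd M) (.snd M') τ
  | lam_cong {Θ M M' σ τ} : LamC (σ :: Θ) M M' τ →
      LamC Θ (.lam σ M) (.lam σ M') (.arr σ τ)
  | app_cong {Θ M M' N N' σ τ} : LamC Θ M M' (.arr σ τ) → LamC Θ N N' σ →
      LamC Θ (.app M N) (.app M' N') τ
  | beta_v {Θ M V σ τ} : LDeriv (σ :: Θ) M τ → LDeriv Θ V σ → LVal V →
      LamC Θ (.app (.lam σ M) V) (LTm.subst0 V M) τ
  | eta_v {Θ V σ τ} : LVal V → LDeriv Θ V (.arr σ τ) →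
      LamC Θ (.lam σ (.app (LTm.shift V) (.var 0))) V (.arr σ τ)
  | fst_beta_v {Θ V W σ τ} : LVal V → LVal W → LDeriv Θ V σ → LDeriv Θ W τ →
      LamC Θ (.fst (.pair V W)) V σ
  | snd_beta_v {Θ V W σ τ} : LVal V → LVal W → LDeriv Θ V σ → LDeriv Θ W τ →
      LamC Θ (.snd (.pair V W)) W τ
  | pair_eta_v {Θ V σ τ} : LVal V → LDeriv Θ V (.prod σ τ) →
      LamC Θ (.pair (.fst V) (.snd V)) V (.prod σ τ)
  | unit_eta_v {Θ V} : LVal V → LDeriv Θ V .unit → LamC Θ V .unit .unit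
  | let_eta {Θ M σ} : LDeriv Θ M σ → LamC Θ (.app (.lam σ (.var 0)) M) M σ
  | let_assoc {Θ M N L σ ρ τ} : LDeriv (σ :: Θ) M τ → LDeriv (ρ :: Θ) N σ →
      LDeriv Θ L ρ →
      LamC Θ (.app (.lam σ M) (.app (.lam ρ N) L))
        (.app (.lam ρ (.app (.lam σ (LTm.rename (Tm.liftN Nat.succ) M)) N)) L) τ
  | app_left {Θ M N σ τ} : LDeriv Θ M (.arr σ τ) → LDeriv Θ N σ →
      LamC Θ (.app M N) (.app (.lam (.arr σ τ) (.app (.var 0) (LTm.shift N))) M) τ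
  | app_right {Θ V N σ τ} : LVal V → LDeriv Θ V (.arr σ τ) → LDeriv Θ N σ →
      LamC Θ (.app V N) (.app (.lam σ (.app (LTm.shift V) (.var 0))) N) τ
  | pair_left {Θ M N σ τ} : LDeriv Θ M σ → LDeriv Θ N τ →
      LamC Θ (.pair M N) (.app (.lam σ (.pair (.var 0) (LTm.shift N))) M) (.prod σ τ)
  | pair_right {Θ V N σ τ} : LVal V → LDeriv Θ V σ → LDeriv Θ N τ →
      LamC Θ (.pair V N) (.app (.lam τ (.pair (LTm.shift V) (.var 0))) N) (.prod σ τ)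
  | fst_cc {Θ M σ τ} : LDeriv Θ M (.prod σ τ) →
      LamC Θ (.fst M) (.app (.lam (.prod σ τ) (.fst (.var 0))) M) σ
  | snd_cc {Θ M σ τ} : LDeriv Θ M (.prod σ τ) →
      LamC Θ (.snd M) (.app (.lam (.prod σ τ) (.snd (.var 0))) M) τ

end EEC

namespace EEC

/-! ## The standard cbv and cbn translations of typed λ-calculus into EEC -/

/-- The computation-type constant `α̲` associated with a simply-typed
λ-calculus type constant `α` (the association is injective but not
surjective, so that some computation-type constants of EEC are different
from `α̲` for every λ-calculus type constant `α`). -/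
def assocC (a : ℕ) : CType := .base (a + 1)

/-- The call-by-value translation `σᵛ` on types. -/
def cbvT : STy → VType
  | .base a => .base a
  | .unit => .unit
  | .prod σ τ => .prod (cbvT σ) (cbvT τ)
  | .arr σ τ => .arr (cbvT σ) (.comp (.bang (cbvT τ)))

/-- The call-by-value translation `Θᵛ` on contexts. -/
def cbvCtx (Θ : List STy) : List VType := Θ.map cbvT

/-- The call-by-value translation on terms: `Θ ⊢ M : τ` is sent to
`Θᵛ ⊢ Mᵛ : !(τᵛ)`. -/
def cbvTm : LTm → Tm
  | .var n => .bang (.var n)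
  | .unit => .bang .unit
  | .pair M N => .banglet (cbvTm M) (.banglet (Tm.shift (cbvTm N)) (.bang (.vpair (.var 1) (.var 0))))
  | .fst M => .banglet (cbvTm M) (.bang (.vfst (.var 0)))
  | .snd M => .banglet (cbvTm M) (.bang (.vsnd (.var 0)))
  | .lam σ M => .bang (.vlam (cbvT σ) (cbvTm M))
  | .app M N => .banglet (cbvTm M) (.banglet (Tm.shift (cbvTm N)) (.vapp (.var 1) (.var 0)))

/-- The call-by-name translation `σⁿ` on types. -/
def cbnT : STy → CType
  | .base a => assocC a
  | .unit => .cunit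
  | .prod σ τ => .cand (cbnT σ) (cbnT τ)
  | .arr σ τ => .carr (.comp (cbnT σ)) (cbnT τ)

/-- The call-by-name translation `Θⁿ` on contexts. -/
def cbnCtx (Θ : List STy) : List VType := Θ.map (fun σ => .comp (cbnT σ))

/-- The call-by-name translation on terms: `Θ ⊢ M : τ` is sent to
`Θⁿ ⊢ Mⁿ : τⁿ`, mimicking each construct by the corresponding
computation-type construct of EEC. -/
def cbnTm : LTm → Tm
  | .var n => .var n
  | .unit => .cunit
  | .pair M N => .cpair (cbnTm M) (cbnTm N)
  | .fst M => .cfst (cbnTm M)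
  | .snd M => .csnd (cbnTm M)
  | .lam σ M => .clam (.comp (cbnT σ)) (cbnTm M)
  | .app M N => .capp (cbnTm M) (cbnTm N)

/-! ## Hasegawa's linear-use CPS translations (Section 4) -/

/-- The call-by-value linear-use CPS translation `σᵛᶜ` on types. -/
def cbvcpsT (R : CType) : STy → VType
  | .base a => .base a
  | .unit => .unit
  | .prod σ τ => .prod (cbvcpsT R σ) (cbvcpsT R τ)
  | .arr σ τ => .arr (cbvcpsT R σ) (.lin (.carr (cbvcpsT R τ) R) R)

/-- `Θᵛᶜ`. -/
def cbvcpsCtx (R : CType) (Θ : List STy) : List VType := Θ.map (cbvcpsT R)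

/-- The call-by-value linear-use CPS translation on terms: `Θ ⊢ M : τ` is
sent to `Θᵛᶜ ⊢ Mᵛᶜ : (τᵛᶜ ⇒ R̲) ⊸ R̲`. -/
def cbvcps (R : CType) : {Θ : List STy} → {M : LTm} → {σ : STy} → LDeriv Θ M σ → Tm
  | _, _, _, .var _ n σ _ => .llam (.carr (cbvcpsT R σ) R) (.capp .svar (.var n))
  | _, _, _, .unit _ => .llam (.carr .unit R) (.capp .svar .unit)
  | _, _, _, .pair _ _ _ σ τ dM dN =>
      .llam (.carr (.prod (cbvcpsT R σ) (cbvcpsT R τ)) R)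
        (.lapp (cbvcps R dM)
          (.clam (cbvcpsT R σ)
            (.lapp (Tm.shift (cbvcps R dN))
              (.clam (cbvcpsT R τ) (.capp .svar (.vpair (.var 1) (.var 0)))))))
  | _, _, _, .fst _ _ σ τ dM =>
      .llam (.carr (cbvcpsT R σ) R)
        (.lapp (cbvcps R dM)
          (.clam (.prod (cbvcpsT R σ) (cbvcpsT R τ)) (.capp .svar (.vfst (.var 0)))))
  | _, _, _, .snd _ _ σ τ dM =>
      .llam (.carr (cbvcpsT R τ) R)
        (.lapp (cbvcps R dM)
          (.clam (.prod (cbvcpsT R σ) (cbvcpsT R τ)) (.capp .svar (.vsnd (.var 0)))))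
  | _, _, _, .lam _ _ σ τ dM =>
      .llam (.carr (.arr (cbvcpsT R σ) (.lin (.carr (cbvcpsT R τ) R) R)) R)
        (.capp .svar (.vlam (cbvcpsT R σ) (cbvcps R dM)))
  | _, _, _, .app _ _ _ σ τ dM dN =>
      .llam (.carr (cbvcpsT R τ) R)
        (.lapp (cbvcps R dM)
          (.clam (.arr (cbvcpsT R σ) (.lin (.carr (cbvcpsT R τ) R) R))
            (.lapp (Tm.shift (cbvcps R dN))
              (.clam (cbvcpsT R σ) (.lapp (.vapp (.var 1) (.var 0)) .svar)))))

/-- The call-by-name linear-use CPS translation `σⁿᶜ` on types. -/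
def cbncpsT (R : CType) : STy → CType
  | .base a => assocC a
  | .unit => .czero
  | .prod σ τ => .csum (cbncpsT R σ) (cbncpsT R τ)
  | .arr σ τ => .copow (.lin (cbncpsT R σ) R) (cbncpsT R τ)

/-- `Θⁿᶜ ⊸ R̲`, assigning each variable `xᵢ : σᵢ` the type `σᵢⁿᶜ ⊸ R̲`. -/
def cbncpsCtx (R : CType) (Θ : List STy) : List VType :=
  Θ.map (fun σ => .lin (cbncpsT R σ) R)

/-- The call-by-name linear-use CPS translation on terms: `Θ ⊢ M : τ` is
sent to `Θⁿᶜ ⊸ R̲ ⊢ Mⁿᶜ : τⁿᶜ ⊸ R̲`. -/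
def cbncps (R : CType) : {Θ : List STy} → {M : LTm} → {σ : STy} → LDeriv Θ M σ → Tm
  | _, _, _, .var _ n _ _ => .var n
  | _, _, _, .unit _ => .llam .czero (.cimage R .svar)
  | _, _, _, .pair _ _ _ σ τ dM dN =>
      .llam (.csum (cbncpsT R σ) (cbncpsT R τ))
        (.ccase .svar (.lapp (cbncps R dM) .svar) (.lapp (cbncps R dN) .svar))
  | _, _, _, .fst _ _ σ _τ dM => .llam (cbncpsT R σ) (.lapp (cbncps R dM) (.cinl .svar))
  | _, _, _, .snd _ _ _ τ dM => .llam (cbncpsT R τ) (.lapp (cbncps R dM) (.cinr .svar))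
  | _, _, _, .lam _ _ σ τ dM =>
      .llam (.copow (.lin (cbncpsT R σ) R) (cbncpsT R τ))
        (.copowlet .svar (.lapp (cbncps R dM) .svar))
  | _, _, _, .app _ _ _ σ τ dM dN =>
      .llam (cbncpsT R τ) (.lapp (cbncps R dM) (.copow (cbncps R dN) .svar))

end EEC

namespace EEC

/-! ## Closed terms, closed maps and retractions -/

/-- A raw term unaffected by renaming and by both kinds of substitution. -/
structure Tm.Closed (t : Tm) : Prop where
  rename : ∀ f, Tm.rename f t = t
  psubst : ∀ s, Tm.psubst s t = t
  ssubst : ∀ u, Tm.ssubst u t = t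

/-- `f` is a closed term of type `A → B`. -/
structure VMap (A B : VType) (f : Tm) where
  closed : f.Closed
  deriv : ∀ Γ, Deriv Γ none f (.arr A B)

/-- `f` is a closed term of type `A ⊸ B`. -/
structure CMap (A B : CType) (f : Tm) where
  closed : f.Closed
  deriv : ∀ Γ, Deriv Γ none f (.lin A B)

/-- Closed terms `f : A → B` and `g : B → A` with `g (f x) = x`. -/
structure VRetract (A B : VType) (f g : Tm) where
  map : VMap A B f
  inv : VMap B A g
  inv_map : ∀ Γ, EEq (A :: Γ) none (.vapp g (.vapp f (.var 0))) (.var 0) A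

/-- Closed terms `f : A ⊸ B` and `g : B ⊸ A` with `g [f [z]] = z`. -/
structure CRetract (A B : CType) (f g : Tm) where
  map : CMap A B f
  inv : CMap B A g
  inv_map : ∀ Γ, EEq Γ (some A) (.lapp g (.lapp f .svar)) .svar (.comp A)

section

variable {Γ : List VType} {Δ : Option CType}

attribute [local simp] Tm.rename Tm.psubst Tm.ssubst Tm.subst0 Tm.shift Tm.liftN Tm.liftS
  Tm.Closed.rename Tm.Closed.psubst Tm.Closed.ssubst

theorem Tm.ssubst_svar (t : Tm) : Tm.ssubst .svar t = t := by
  induction t <;> simp_all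

/-- A term typed with an empty stoup does not contain the stoup variable. -/
theorem Deriv.ssubst_eq {t A} (d : Deriv Γ none t A) : ∀ u, Tm.ssubst u t = t := by
  generalize hΔ : (none : Option CType) = Δ at d
  induction d <;> simp_all

/-! ### Application of closed maps -/

def VMap.app {A B f t} (h : VMap A B f) (d : Deriv Γ none t A) : Deriv Γ none (.vapp f t) B :=
  .vapp _ _ _ _ _ (h.deriv Γ) d

def CMap.app {A B f t} (h : CMap A B f) (d : Deriv Γ Δ t (.comp A)) :
    Deriv Γ Δ (.lapp f t) (.comp B) :=
  .lapp _ _ _ _ _ _ (h.deriv Γ) d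

theorem VMap.congr {A B f t t'} (h : VMap A B f) (e : EEq Γ none t t' A) :
    EEq Γ none (.vapp f t) (.vapp f t') B :=
  .vapp_cong (.refl (h.deriv Γ)) e

theorem CMap.congr {A B f t t'} (h : CMap A B f) (e : EEq Γ Δ t t' (.comp A)) :
    EEq Γ Δ (.lapp f t) (.lapp f t') (.comp B) :=
  .lapp_cong (.refl (h.deriv Γ)) e

theorem VRetract.inv_map_app {A B f g t} (h : VRetract A B f g) (d : Deriv Γ none t A) :
    EEq Γ none (.vapp g (.vapp f t)) t A := by
  have e := EEq.vapp_cong (.vlam_cong (h.inv_map Γ)) (.refl d)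
  have hb := EEq.vlam_beta (h.inv.app (h.map.app (.var (A :: Γ) 0 A rfl))) d
  have hb' := EEq.vlam_beta (.var (A :: Γ) 0 A rfl) d
  simp [h.map.closed, h.inv.closed] at hb hb'
  exact hb.symm.trans (e.trans hb')

theorem CRetract.inv_map_app {A B f g t} (h : CRetract A B f g) (d : Deriv Γ Δ t (.comp A)) :
    EEq Γ Δ (.lapp g (.lapp f t)) t (.comp A) := by
  have e := EEq.lapp_cong (.llam_cong (h.inv_map Γ)) (.refl d)
  have hb := EEq.llam_beta (h.inv.app (h.map.app (.svar Γ A))) d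
  have hb' := EEq.llam_beta (.svar Γ A) d
  simp [h.map.closed, h.inv.closed] at hb hb'
  exact hb.symm.trans (e.trans hb')

/-! ### Extensionality for the stoup variable -/

theorem EEq.iunit_ext {u u' A} (d : Deriv Γ (some .iunit) u (.comp A))
    (d' : Deriv Γ (some .iunit) u' (.comp A))
    (e : EEq Γ none (Tm.ssubst .top u) (Tm.ssubst .top u') (.comp A)) :
    EEq Γ (some .iunit) u u' (.comp A) := by
  have hb := EEq.ilet_eta (.svar Γ .iunit) d
  have hb' := EEq.ilet_eta (.svar Γ .iunit) d'
  rw [Tm.ssubst_svar] at hb hb'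
  exact hb.symm.trans (.trans (.ilet_cong (.refl (.svar _ _)) e) hb')

theorem EEq.bang_ext {u u' A B} (d : Deriv Γ (some (.bang A)) u (.comp B))
    (d' : Deriv Γ (some (.bang A)) u' (.comp B))
    (e : EEq (A :: Γ) none (Tm.ssubst (.bang (.var 0)) (Tm.shift u))
      (Tm.ssubst (.bang (.var 0)) (Tm.shift u')) (.comp B)) :
    EEq Γ (some (.bang A)) u u' (.comp B) := by
  have hb := EEq.bang_eta (.svar Γ (.bang A)) d
  have hb' := EEq.bang_eta (.svar Γ (.bang A)) d'
  rw [Tm.ssubst_svar] at hb hb'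
  exact hb.symm.trans (.trans (.banglet_cong (.refl (.svar _ _)) e) hb')

theorem EEq.copow_ext {u u' A B C} (d : Deriv Γ (some (.copow A B)) u (.comp C))
    (d' : Deriv Γ (some (.copow A B)) u' (.comp C))
    (e : EEq (A :: Γ) (some B) (Tm.ssubst (.copow (.var 0) .svar) (Tm.shift u))
      (Tm.ssubst (.copow (.var 0) .svar) (Tm.shift u')) (.comp C)) :
    EEq Γ (some (.copow A B)) u u' (.comp C) := by
  have hb := EEq.copow_eta (.svar Γ (.copow A B)) d
  have hb' := EEq.copow_eta (.svar Γ (.copow A B)) d'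
  rw [Tm.ssubst_svar] at hb hb'
  exact hb.symm.trans (.trans (.copowlet_cong (.refl (.svar _ _)) e) hb')

theorem EEq.csum_ext {u u' A B C} (d : Deriv Γ (some (.csum A B)) u (.comp C))
    (d' : Deriv Γ (some (.csum A B)) u' (.comp C))
    (e₁ : EEq Γ (some A) (Tm.ssubst (.cinl .svar) u) (Tm.ssubst (.cinl .svar) u') (.comp C))
    (e₂ : EEq Γ (some B) (Tm.ssubst (.cinr .svar) u) (Tm.ssubst (.cinr .svar) u') (.comp C)) :
    EEq Γ (some (.csum A B)) u u' (.comp C) := by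
  have hb := EEq.csum_eta (.svar Γ (.csum A B)) d
  have hb' := EEq.csum_eta (.svar Γ (.csum A B)) d'
  rw [Tm.ssubst_svar] at hb hb'
  exact hb.symm.trans (.trans (.ccase_cong (.refl (.svar _ _)) e₁ e₂) hb')

/-! ### Identities and terminal types -/

def VRetract.id (A : VType) : VRetract A A (.vlam A (.var 0)) (.vlam A (.var 0)) where
  map := ⟨by constructor <;> simp, fun Γ => .vlam _ _ _ _ (.var _ _ _ rfl)⟩
  inv := ⟨by constructor <;> simp, fun Γ => .vlam _ _ _ _ (.var _ _ _ rfl)⟩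
  inv_map Γ := by
    have hb := EEq.vlam_beta (.var (A :: A :: Γ) 0 A rfl) (.var (A :: Γ) 0 A rfl)
    exact .trans (.vapp_cong (.refl (.vlam _ _ _ _ (.var _ _ _ rfl))) hb) hb

def CRetract.id (A : CType) : CRetract A A (.llam A .svar) (.llam A .svar) where
  map := ⟨by constructor <;> simp, fun Γ => .llam _ _ _ _ (.svar _ _)⟩
  inv := ⟨by constructor <;> simp, fun Γ => .llam _ _ _ _ (.svar _ _)⟩
  inv_map Γ := by
    have hb := EEq.llam_beta (.svar Γ A) (.svar Γ A)
    exact .trans (.lapp_cong (.refl (.llam _ _ _ _ (.svar _ _))) hb) hb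

def VRetract.unit : VRetract .unit .unit (.vlam .unit .unit) (.vlam .unit .unit) where
  map := ⟨by constructor <;> simp, fun Γ => .vlam _ _ _ _ (.unit _)⟩
  inv := ⟨by constructor <;> simp, fun Γ => .vlam _ _ _ _ (.unit _)⟩
  inv_map Γ := by
    have m : ∀ Γ, Deriv Γ none (.vlam .unit .unit) (.arr .unit .unit) :=
      fun Γ => .vlam _ _ _ _ (.unit _)
    have d : Deriv (.unit :: Γ) none (.var 0) .unit := .var _ _ _ rfl
    exact (EEq.unit_eta (.vapp _ _ _ _ _ (m _) (.vapp _ _ _ _ _ (m _) d))).trans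
      (EEq.unit_eta d).symm

def CRetract.cunit : CRetract .cunit .cunit (.llam .cunit .cunit) (.llam .cunit .cunit) where
  map := ⟨by constructor <;> simp, fun Γ => .llam _ _ _ _ (.cunit _ _)⟩
  inv := ⟨by constructor <;> simp, fun Γ => .llam _ _ _ _ (.cunit _ _)⟩
  inv_map Γ := by
    have m : ∀ Γ, Deriv Γ none (.llam .cunit .cunit) (.lin .cunit .cunit) :=
      fun Γ => .llam _ _ _ _ (.cunit _ _)
    exact (EEq.cunit_eta (.lapp _ _ _ _ _ _ (m _) (.lapp _ _ _ _ _ _ (m _) (.svar _ _)))).trans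
      (EEq.cunit_eta (.svar _ _)).symm

/-! ### Functoriality of the type constructors -/

/-- The action of `×` on maps. -/
def Tm.prodMap (A B : VType) (f h : Tm) : Tm :=
  .vlam (.prod A B) (.vpair (.vapp f (.vfst (.var 0))) (.vapp h (.vsnd (.var 0))))

/-- The action of `→` on maps. -/
def Tm.arrMap (A B A' : VType) (g h : Tm) : Tm :=
  .vlam (.arr A B) (.vlam A' (.vapp h (.vapp (.var 1) (.vapp g (.var 0)))))

/-- The action of `⊸` on maps. -/
def Tm.linMap (A B A' : CType) (g h : Tm) : Tm :=
  .vlam (.lin A B) (.llam A' (.lapp h (.lapp (.var 0) (.lapp g .svar))))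

/-- The action of `&` on maps. -/
def Tm.candMap (A B : CType) (f h : Tm) : Tm :=
  .llam (.cand A B) (.cpair (.lapp f (.cfst .svar)) (.lapp h (.csnd .svar)))

/-- The action of `⇒` on maps. -/
def Tm.carrMap (A : VType) (B : CType) (A' : VType) (g h : Tm) : Tm :=
  .llam (.carr A B) (.clam A' (.lapp h (.capp .svar (.vapp g (.var 0)))))

/-- The action of `!(-) ⊗ (-)` on maps. -/
def Tm.copowMap (A : VType) (B : CType) (f h : Tm) : Tm :=
  .llam (.copow A B) (.copowlet .svar (.copow (.vapp f (.var 0)) (.lapp h .svar)))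

/-- The action of `⊕` on maps. -/
def Tm.csumMap (A B : CType) (f h : Tm) : Tm :=
  .llam (.csum A B) (.ccase .svar (.cinl (.lapp f .svar)) (.cinr (.lapp h .svar)))

attribute [local simp] Tm.prodMap Tm.arrMap Tm.linMap Tm.candMap Tm.carrMap Tm.copowMap Tm.csumMap

def VMap.prod {A A' B B' f h} (F : VMap A A' f) (H : VMap B B' h) :
    VMap (.prod A B) (.prod A' B') (.prodMap A B f h) where
  closed := by constructor <;> simp [F.closed, H.closed]
  deriv Γ := .vlam _ _ _ _ (.vpair _ _ _ _ _ (F.app (.vfst _ _ _ _ (.var _ _ _ rfl)))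
    (H.app (.vsnd _ _ _ _ (.var _ _ _ rfl))))

theorem VMap.prod_app {A A' B B' f h t} (F : VMap A A' f) (H : VMap B B' h)
    (d : Deriv Γ none t (.prod A B)) :
    EEq Γ none (.vapp (.prodMap A B f h) t) (.vpair (.vapp f (.vfst t)) (.vapp h (.vsnd t)))
      (.prod A' B') := by
  have hb := EEq.vlam_beta (.vpair _ _ _ _ _ (F.app (.vfst _ _ _ _ (.var (.prod A B :: Γ) 0 _ rfl)))
    (H.app (.vsnd _ _ _ _ (.var _ 0 _ rfl)))) d
  simpa [F.closed, H.closed] using hb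

def VRetract.prod {A A' B B' f g h k} (F : VRetract A A' f g) (H : VRetract B B' h k) :
    VRetract (.prod A B) (.prod A' B') (.prodMap A B f h) (.prodMap A' B' g k) where
  map := F.map.prod H.map
  inv := F.inv.prod H.inv
  inv_map Γ := by
    have d : Deriv (.prod A B :: Γ) none (.var 0) (.prod A B) := .var _ _ _ rfl
    have d₁ := F.map.app (.vfst _ _ _ _ d)
    have d₂ := H.map.app (.vsnd _ _ _ _ d)
    refine .trans ((F.inv.prod H.inv).congr (F.map.prod_app H.map d)) ?_
    refine .trans (F.inv.prod_app H.inv (.vpair _ _ _ _ _ d₁ d₂)) ?_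
    refine .trans (.vpair_cong (F.inv.congr (.vfst_beta d₁ d₂))
      (H.inv.congr (.vsnd_beta d₁ d₂))) ?_
    exact .trans (.vpair_cong (F.inv_map_app (.vfst _ _ _ _ d))
      (H.inv_map_app (.vsnd _ _ _ _ d))) (.vpair_eta d)

def VMap.arr {A A' B B' g h} (G : VMap A' A g) (H : VMap B B' h) :
    VMap (.arr A B) (.arr A' B') (.arrMap A B A' g h) where
  closed := by constructor <;> simp [G.closed, H.closed]
  deriv Γ := .vlam _ _ _ _ (.vlam _ _ _ _ (H.app (.vapp _ _ _ _ _ (.var _ _ _ rfl)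
    (G.app (.var _ _ _ rfl)))))

theorem VMap.arr_app {A A' B B' g h t} (G : VMap A' A g) (H : VMap B B' h)
    (d : Deriv Γ none t (.arr A B)) :
    EEq Γ none (.vapp (.arrMap A B A' g h) t)
      (.vlam A' (.vapp h (.vapp (.shift t) (.vapp g (.var 0))))) (.arr A' B') := by
  have hb := EEq.vlam_beta (.vlam _ _ A' _ (H.app (.vapp _ _ _ A B
    (.var (A' :: .arr A B :: Γ) 1 _ rfl) (G.app (.var _ 0 _ rfl))))) d
  simpa [G.closed, H.closed] using hb

def VRetract.arr {A A' B B' f g h k} (F : VRetract A A' f g) (H : VRetract B B' h k) :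
    VRetract (.arr A B) (.arr A' B') (.arrMap A B A' g h) (.arrMap A' B' A f k) where
  map := F.inv.arr H.map
  inv := F.map.arr H.inv
  inv_map Γ := by
    have d : Deriv (.arr A B :: Γ) none (.var 0) (.arr A B) := .var _ _ _ rfl
    have x : Deriv (A :: .arr A B :: Γ) none (.var 0) A := .var _ _ _ rfl
    have y : Deriv (A :: .arr A B :: Γ) none (.var 1) (.arr A B) := .var _ _ _ rfl
    have d₁ : Deriv (A' :: .arr A B :: Γ) none (.vapp h (.vapp (.var 1) (.vapp g (.var 0)))) B' :=
      H.map.app (.vapp _ _ _ _ _ (.var _ _ _ rfl) (F.inv.app (.var _ _ _ rfl)))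
    have d₂ : Deriv (A' :: A :: .arr A B :: Γ) none
        (.vapp h (.vapp (.var 2) (.vapp g (.var 0)))) B' :=
      H.map.app (.vapp _ _ _ _ _ (.var _ _ _ rfl) (F.inv.app (.var _ _ _ rfl)))
    refine .trans ((F.map.arr H.inv).congr (F.inv.arr_app H.map d)) ?_
    refine .trans (F.map.arr_app H.inv (.vlam _ _ _ _ d₁)) ?_
    refine .trans (.vlam_cong ?_) (.vlam_eta d)
    have hb := EEq.vlam_beta d₂ (F.map.app x)
    simp [F.inv.closed, H.map.closed] at hb ⊢
    refine .trans (H.inv.congr hb) ?_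
    refine .trans (H.inv_map_app (.vapp _ _ _ _ _ y (F.inv.app (F.map.app x)))) ?_
    exact .vapp_cong (.refl y) (F.inv_map_app x)

def CMap.lin {A A' B B' g h} (G : CMap A' A g) (H : CMap B B' h) :
    VMap (.lin A B) (.lin A' B') (.linMap A B A' g h) where
  closed := by constructor <;> simp [G.closed, H.closed]
  deriv Γ := .vlam _ _ _ _ (.llam _ _ _ _ (H.app (.lapp _ _ _ _ _ _ (.var _ _ _ rfl)
    (G.app (.svar _ _)))))

theorem CMap.lin_app {A A' B B' g h t} (G : CMap A' A g) (H : CMap B B' h)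
    (d : Deriv Γ none t (.lin A B)) :
    EEq Γ none (.vapp (.linMap A B A' g h) t)
      (.llam A' (.lapp h (.lapp t (.lapp g .svar)))) (.lin A' B') := by
  have hb := EEq.vlam_beta (.llam _ _ A' _ (H.app (.lapp _ _ _ _ A B
    (.var (.lin A B :: Γ) 0 _ rfl) (G.app (.svar _ _))))) d
  simpa [G.closed, H.closed] using hb

def CRetract.lin {A A' B B' f g h k} (F : CRetract A A' f g) (H : CRetract B B' h k) :
    VRetract (.lin A B) (.lin A' B') (.linMap A B A' g h) (.linMap A' B' A f k) where
  map := F.inv.lin H.map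
  inv := F.map.lin H.inv
  inv_map Γ := by
    have d : Deriv (.lin A B :: Γ) none (.var 0) (.lin A B) := .var _ _ _ rfl
    have d₁ : Deriv (.lin A B :: Γ) (some A') (.lapp h (.lapp (.var 0) (.lapp g .svar)))
        (.comp B') := H.map.app (.lapp _ _ _ _ _ _ d (F.inv.app (.svar _ _)))
    have x : Deriv (.lin A B :: Γ) (some A) .svar (.comp A) := .svar _ _
    refine .trans ((F.map.lin H.inv).congr (F.inv.lin_app H.map d)) ?_
    refine .trans (F.map.lin_app H.inv (.llam _ _ _ _ d₁)) ?_
    refine .trans (.llam_cong ?_) (.llam_eta d)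
    have hb := EEq.llam_beta d₁ (F.map.app x)
    simp [F.inv.closed, H.map.closed] at hb
    refine .trans (H.inv.congr hb) ?_
    refine .trans (H.inv_map_app (.lapp _ _ _ _ _ _ d (F.inv.app (F.map.app x)))) ?_
    exact .lapp_cong (.refl d) (F.inv_map_app x)

def CMap.cand {A A' B B' f h} (F : CMap A A' f) (H : CMap B B' h) :
    CMap (.cand A B) (.cand A' B') (.candMap A B f h) where
  closed := by constructor <;> simp [F.closed, H.closed]
  deriv Γ := .llam _ _ _ _ (.cpair _ _ _ _ _ _ (F.app (.cfst _ _ _ _ _ (.svar _ _)))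
    (H.app (.csnd _ _ _ _ _ (.svar _ _))))

theorem CMap.cand_app {A A' B B' f h t} (F : CMap A A' f) (H : CMap B B' h)
    (d : Deriv Γ Δ t (.comp (.cand A B))) :
    EEq Γ Δ (.lapp (.candMap A B f h) t) (.cpair (.lapp f (.cfst t)) (.lapp h (.csnd t)))
      (.comp (.cand A' B')) := by
  have hb := EEq.llam_beta (.cpair _ _ _ _ _ _ (F.app (.cfst _ _ _ _ _ (.svar Γ (.cand A B))))
    (H.app (.csnd _ _ _ _ _ (.svar _ _)))) d
  simpa [F.closed, H.closed] using hb

def CRetract.cand {A A' B B' f g h k} (F : CRetract A A' f g) (H : CRetract B B' h k) :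
    CRetract (.cand A B) (.cand A' B') (.candMap A B f h) (.candMap A' B' g k) where
  map := F.map.cand H.map
  inv := F.inv.cand H.inv
  inv_map Γ := by
    have d : Deriv Γ (some (.cand A B)) .svar (.comp (.cand A B)) := .svar _ _
    have d₁ := F.map.app (.cfst _ _ _ _ _ d)
    have d₂ := H.map.app (.csnd _ _ _ _ _ d)
    refine .trans ((F.inv.cand H.inv).congr (F.map.cand_app H.map d)) ?_
    refine .trans (F.inv.cand_app H.inv (.cpair _ _ _ _ _ _ d₁ d₂)) ?_
    refine .trans (.cpair_cong (F.inv.congr (.cfst_beta d₁ d₂))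
      (H.inv.congr (.csnd_beta d₁ d₂))) ?_
    exact .trans (.cpair_cong (F.inv_map_app (.cfst _ _ _ _ _ d))
      (H.inv_map_app (.csnd _ _ _ _ _ d))) (.cpair_eta d)

def CMap.carr {A A' B B' g h} (G : VMap A' A g) (H : CMap B B' h) :
    CMap (.carr A B) (.carr A' B') (.carrMap A B A' g h) where
  closed := by constructor <;> simp [G.closed, H.closed]
  deriv Γ := .llam _ _ _ _ (.clam _ _ _ _ _ (H.app (.capp _ _ _ _ _ _ (.svar _ _)
    (G.app (.var _ _ _ rfl)))))

theorem CMap.carr_app {A A' B B' g h t} (G : VMap A' A g) (H : CMap B B' h)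
    (d : Deriv Γ Δ t (.comp (.carr A B))) :
    EEq Γ Δ (.lapp (.carrMap A B A' g h) t)
      (.clam A' (.lapp h (.capp (.shift t) (.vapp g (.var 0))))) (.comp (.carr A' B')) := by
  have hb := EEq.llam_beta (.clam _ _ _ A' _ (H.app (.capp _ _ _ _ A B
    (.svar (A' :: Γ) (.carr A B)) (G.app (.var _ 0 _ rfl))))) d
  simpa [G.closed, H.closed] using hb

def CRetract.carr {A A' B B' f g h k} (F : VRetract A A' f g) (H : CRetract B B' h k) :
    CRetract (.carr A B) (.carr A' B') (.carrMap A B A' g h) (.carrMap A' B' A f k) where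
  map := .carr F.inv H.map
  inv := .carr F.map H.inv
  inv_map Γ := by
    have d : ∀ Γ, Deriv Γ (some (.carr A B)) .svar (.comp (.carr A B)) := fun Γ => .svar _ _
    have x : Deriv (A :: Γ) none (.var 0) A := .var _ _ _ rfl
    have d₁ : ∀ Γ, Deriv (A' :: Γ) (some (.carr A B))
        (.lapp h (.capp .svar (.vapp g (.var 0)))) (.comp B') :=
      fun Γ => H.map.app (.capp _ _ _ _ _ _ (d _) (F.inv.app (.var _ _ _ rfl)))
    refine .trans ((CMap.carr F.map H.inv).congr (CMap.carr_app F.inv H.map (d _))) ?_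
    refine .trans (CMap.carr_app F.map H.inv (.clam _ _ _ _ _ (d₁ _))) ?_
    refine .trans (.clam_cong ?_) (.clam_eta (d _))
    have hb := EEq.clam_beta (d₁ _) (F.map.app x)
    simp [F.inv.closed, H.map.closed] at hb ⊢
    refine .trans (H.inv.congr hb) ?_
    refine .trans (H.inv_map_app (.capp _ _ _ _ _ _ (d _) (F.inv.app (F.map.app x)))) ?_
    exact .capp_cong (.refl (d _)) (F.inv_map_app x)

def CMap.copow {A A' B B' f h} (F : VMap A A' f) (H : CMap B B' h) :
    CMap (.copow A B) (.copow A' B') (.copowMap A B f h) where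
  closed := by constructor <;> simp [F.closed, H.closed]
  deriv Γ := .llam _ _ _ _ (.copowlet _ _ _ _ _ _ _ (.svar _ _)
    (.copow _ _ _ _ _ _ (F.app (.var _ _ _ rfl)) (H.app (.svar _ _))))

theorem CMap.copow_app {A A' B B' f h s t} (F : VMap A A' f) (H : CMap B B' h)
    (ds : Deriv Γ none s A) (dt : Deriv Γ Δ t (.comp B)) :
    EEq Γ Δ (.lapp (.copowMap A B f h) (.copow s t)) (.copow (.vapp f s) (.lapp h t))
      (.comp (.copow A' B')) := by
  have d : Deriv (A :: Γ) (some B) (.copow (.vapp f (.var 0)) (.lapp h .svar))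
      (.comp (.copow A' B')) :=
    .copow _ _ _ _ _ _ (F.app (.var _ _ _ rfl)) (H.app (.svar _ _))
  have hb := EEq.llam_beta (.copowlet _ _ _ _ _ _ _ (.svar Γ (.copow A B)) d)
    (.copow _ _ _ _ _ _ ds dt)
  have hb' := EEq.copow_beta ds dt d
  simp [F.closed, H.closed, ds.ssubst_eq] at hb hb'
  exact hb.trans hb'

def CRetract.copow {A A' B B' f g h k} (F : VRetract A A' f g) (H : CRetract B B' h k) :
    CRetract (.copow A B) (.copow A' B') (.copowMap A B f h) (.copowMap A' B' g k) where
  map := .copow F.map H.map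
  inv := .copow F.inv H.inv
  inv_map Γ := by
    have M := CMap.copow F.map H.map
    have N := CMap.copow F.inv H.inv
    refine .copow_ext (N.app (M.app (.svar _ _))) (.svar _ _) ?_
    have x : Deriv (A :: Γ) none (.var 0) A := .var _ _ _ rfl
    have z : Deriv (A :: Γ) (some B) .svar (.comp B) := .svar _ _
    simp only [Tm.shift, Tm.rename, Tm.ssubst, M.closed.rename, M.closed.ssubst, N.closed.rename,
      N.closed.ssubst]
    refine .trans (N.congr (CMap.copow_app F.map H.map x z)) ?_
    refine .trans (CMap.copow_app F.inv H.inv (F.map.app x) (H.map.app z)) ?_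
    exact .copow_cong (F.inv_map_app x) (H.inv_map_app z)

def CMap.csum {A A' B B' f h} (F : CMap A A' f) (H : CMap B B' h) :
    CMap (.csum A B) (.csum A' B') (.csumMap A B f h) where
  closed := by constructor <;> simp [F.closed, H.closed]
  deriv Γ := .llam _ _ _ _ (.ccase _ _ _ _ _ _ _ _ (.svar _ _)
    (.cinl _ _ _ _ _ (F.app (.svar _ _))) (.cinr _ _ _ _ _ (H.app (.svar _ _))))

theorem CMap.csum_app_inl {A A' B B' f h t} (F : CMap A A' f) (H : CMap B B' h)
    (d : Deriv Γ Δ t (.comp A)) :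
    EEq Γ Δ (.lapp (.csumMap A B f h) (.cinl t)) (.cinl (.lapp f t)) (.comp (.csum A' B')) := by
  have l : Deriv Γ (some A) (.cinl (.lapp f .svar)) (.comp (.csum A' B')) :=
    .cinl _ _ _ _ _ (F.app (.svar _ _))
  have r : Deriv Γ (some B) (.cinr (.lapp h .svar)) (.comp (.csum A' B')) :=
    .cinr _ _ _ _ _ (H.app (.svar _ _))
  have hb := EEq.llam_beta (.ccase _ _ _ _ _ _ _ _ (.svar Γ (.csum A B)) l r) (.cinl _ _ _ _ _ d)
  have hb' := EEq.csum_beta_inl l r d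
  simp [F.closed] at hb hb'
  exact hb.trans hb'

theorem CMap.csum_app_inr {A A' B B' f h t} (F : CMap A A' f) (H : CMap B B' h)
    (d : Deriv Γ Δ t (.comp B)) :
    EEq Γ Δ (.lapp (.csumMap A B f h) (.cinr t)) (.cinr (.lapp h t)) (.comp (.csum A' B')) := by
  have l : Deriv Γ (some A) (.cinl (.lapp f .svar)) (.comp (.csum A' B')) :=
    .cinl _ _ _ _ _ (F.app (.svar _ _))
  have r : Deriv Γ (some B) (.cinr (.lapp h .svar)) (.comp (.csum A' B')) :=
    .cinr _ _ _ _ _ (H.app (.svar _ _))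
  have hb := EEq.llam_beta (.ccase _ _ _ _ _ _ _ _ (.svar Γ (.csum A B)) l r) (.cinr _ _ _ _ _ d)
  have hb' := EEq.csum_beta_inr l r d
  simp [H.closed] at hb hb'
  exact hb.trans hb'

def CRetract.csum {A A' B B' f g h k} (F : CRetract A A' f g) (H : CRetract B B' h k) :
    CRetract (.csum A B) (.csum A' B') (.csumMap A B f h) (.csumMap A' B' g k) where
  map := .csum F.map H.map
  inv := .csum F.inv H.inv
  inv_map Γ := by
    have M := CMap.csum F.map H.map
    have N := CMap.csum F.inv H.inv
    refine .csum_ext (N.app (M.app (.svar _ _))) (.svar _ _) ?_ ?_ <;>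
      simp only [Tm.ssubst, M.closed.ssubst, N.closed.ssubst]
    · refine .trans (N.congr (CMap.csum_app_inl F.map H.map (.svar _ _))) ?_
      refine .trans (CMap.csum_app_inl F.inv H.inv (F.map.app (.svar _ _))) ?_
      exact .cinl_cong (F.inv_map _)
    · refine .trans (N.congr (CMap.csum_app_inr F.map H.map (.svar _ _))) ?_
      refine .trans (CMap.csum_app_inr F.inv H.inv (H.map.app (.svar _ _))) ?_
      exact .cinr_cong (H.inv_map _)

/-! ### The isomorphism `!A' ⊗ I̲ ≅ !A` -/

/-- The map `!A' ⊗ I̲ ⊸ !A` induced by `f : A' → A`. -/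
def Tm.ofCopowUnit (A' : VType) (f : Tm) : Tm :=
  .llam (.copow A' .iunit) (.copowlet .svar (.ilet .svar (.bang (.vapp f (.var 0)))))

/-- The map `!A ⊸ !A' ⊗ I̲` induced by `g : A → A'`. -/
def Tm.toCopowUnit (A : VType) (g : Tm) : Tm :=
  .llam (.bang A) (.banglet .svar (.copow (.vapp g (.var 0)) .top))

attribute [local simp] Tm.ofCopowUnit Tm.toCopowUnit

def CMap.ofCopowUnit {A' A f} (F : VMap A' A f) :
    CMap (.copow A' .iunit) (.bang A) (.ofCopowUnit A' f) where
  closed := by constructor <;> simp [F.closed]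
  deriv Γ := .llam _ _ _ _ (.copowlet _ _ _ _ _ _ _ (.svar _ _)
    (.ilet _ _ _ _ _ (.svar _ _) (.bang _ _ _ (F.app (.var _ _ _ rfl)))))

def CMap.toCopowUnit {A A' g} (G : VMap A A' g) :
    CMap (.bang A) (.copow A' .iunit) (.toCopowUnit A g) where
  closed := by constructor <;> simp [G.closed]
  deriv Γ := .llam _ _ _ _ (.banglet _ _ _ _ _ _ (.svar _ _)
    (.copow _ _ _ _ _ _ (G.app (.var _ _ _ rfl)) (.top _)))

theorem CMap.ofCopowUnit_app {A' A f t} (F : VMap A' A f) (d : Deriv Γ none t A') :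
    EEq Γ none (.lapp (.ofCopowUnit A' f) (.copow t .top)) (.bang (.vapp f t))
      (.comp (.bang A)) := by
  have d₁ : Deriv (A' :: Γ) (some .iunit) (.ilet .svar (.bang (.vapp f (.var 0))))
      (.comp (.bang A)) :=
    .ilet _ _ _ _ _ (.svar _ _) (.bang _ _ _ (F.app (.var _ _ _ rfl)))
  have hb := EEq.llam_beta (.copowlet _ _ _ _ _ _ _ (.svar Γ (.copow A' .iunit)) d₁)
    (.copow _ _ _ _ _ _ d (.top _))
  have hb' := EEq.copow_beta d (.top _) d₁
  simp [F.closed, d.ssubst_eq] at hb hb'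
  exact hb.trans (hb'.trans (.ilet_beta (.bang _ _ _ (F.app d))))

theorem CMap.toCopowUnit_app {A A' g t} (G : VMap A A' g) (d : Deriv Γ none t A) :
    EEq Γ none (.lapp (.toCopowUnit A g) (.bang t)) (.copow (.vapp g t) .top)
      (.comp (.copow A' .iunit)) := by
  have d₁ : Deriv (A :: Γ) none (.copow (.vapp g (.var 0)) .top) (.comp (.copow A' .iunit)) :=
    .copow _ _ _ _ _ _ (G.app (.var _ _ _ rfl)) (.top _)
  have hb := EEq.llam_beta (.banglet _ _ _ _ _ _ (.svar Γ (.bang A)) d₁) (.bang _ _ _ d)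
  have hb' := EEq.bang_beta d d₁
  simp [G.closed] at hb hb'
  exact hb.trans hb'

def CRetract.ofCopowUnit {A' A f g} (F : VRetract A' A f g) :
    CRetract (.copow A' .iunit) (.bang A) (.ofCopowUnit A' f) (.toCopowUnit A g) where
  map := .ofCopowUnit F.map
  inv := .toCopowUnit F.inv
  inv_map Γ := by
    have M := CMap.ofCopowUnit F.map
    have N := CMap.toCopowUnit F.inv
    have x : Deriv (A' :: Γ) none (.var 0) A' := .var _ _ _ rfl
    have p : Deriv (A' :: Γ) (some .iunit) (.copow (.var 0) .svar) (.comp (.copow A' .iunit)) :=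
      .copow _ _ _ _ _ _ x (.svar _ _)
    refine .copow_ext (N.app (M.app (.svar _ _))) (.svar _ _) ?_
    simp only [Tm.shift, Tm.rename, Tm.ssubst, M.closed.rename, M.closed.ssubst, N.closed.rename,
      N.closed.ssubst]
    refine .iunit_ext (N.app (M.app p)) p ?_
    simp only [Tm.ssubst, M.closed.ssubst, N.closed.ssubst]
    refine .trans (N.congr (CMap.ofCopowUnit_app F.map x)) ?_
    refine .trans (CMap.toCopowUnit_app F.inv (F.map.app x)) ?_
    exact .copow_cong (F.inv_map_app x) (.refl (.top _))

def CRetract.toCopowUnit {A A' f g} (F : VRetract A A' f g) :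
    CRetract (.bang A) (.copow A' .iunit) (.toCopowUnit A f) (.ofCopowUnit A' g) where
  map := .toCopowUnit F.map
  inv := .ofCopowUnit F.inv
  inv_map Γ := by
    have M := CMap.toCopowUnit F.map
    have N := CMap.ofCopowUnit F.inv
    have x : Deriv (A :: Γ) none (.var 0) A := .var _ _ _ rfl
    refine .bang_ext (N.app (M.app (.svar _ _))) (.svar _ _) ?_
    simp only [Tm.shift, Tm.rename, Tm.ssubst, M.closed.rename, M.closed.ssubst, N.closed.rename,
      N.closed.ssubst]
    refine .trans (N.congr (CMap.toCopowUnit_app F.map x)) ?_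
    refine .trans (CMap.ofCopowUnit_app F.inv (F.map.app x)) ?_
    exact .bang_cong (F.inv_map_app x)

/-! ### The isomorphism `I̲ ⊸ A̲' ≅ A̲` -/

/-- The map `(I̲ ⊸ A̲') → A̲` induced by `f : A̲' ⊸ A̲`. -/
def Tm.ofLinUnit (A' : CType) (f : Tm) : Tm :=
  .vlam (.lin .iunit A') (.lapp f (.lapp (.var 0) .top))

/-- The map `A̲ → (I̲ ⊸ A̲')` induced by `g : A̲ ⊸ A̲'`. -/
def Tm.toLinUnit (A : CType) (g : Tm) : Tm :=
  .vlam (.comp A) (.llam .iunit (.ilet .svar (.lapp g (.var 0))))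

attribute [local simp] Tm.ofLinUnit Tm.toLinUnit

def CMap.ofLinUnit {A' A f} (F : CMap A' A f) :
    VMap (.lin .iunit A') (.comp A) (.ofLinUnit A' f) where
  closed := by constructor <;> simp [F.closed]
  deriv Γ := .vlam _ _ _ _ (F.app (.lapp _ _ _ _ _ _ (.var _ _ _ rfl) (.top _)))

def CMap.toLinUnit {A A' g} (G : CMap A A' g) :
    VMap (.comp A) (.lin .iunit A') (.toLinUnit A g) where
  closed := by constructor <;> simp [G.closed]
  deriv Γ := .vlam _ _ _ _ (.llam _ _ _ _ (.ilet _ _ _ _ _ (.svar _ _)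
    (G.app (.var _ _ _ rfl))))

theorem CMap.ofLinUnit_app {A' A f t} (F : CMap A' A f) (d : Deriv Γ none t (.lin .iunit A')) :
    EEq Γ none (.vapp (.ofLinUnit A' f) t) (.lapp f (.lapp t .top)) (.comp A) := by
  have hb := EEq.vlam_beta
    (F.app (.lapp _ _ _ _ _ _ (.var (.lin .iunit A' :: Γ) 0 _ rfl) (.top _))) d
  simpa [F.closed] using hb

theorem CMap.toLinUnit_app {A A' g t} (G : CMap A A' g) (d : Deriv Γ none t (.comp A)) :
    EEq Γ none (.vapp (.toLinUnit A g) t) (.llam .iunit (.ilet .svar (.lapp g t)))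
      (.lin .iunit A') := by
  have hb := EEq.vlam_beta (.llam _ _ _ _ (.ilet _ _ _ _ _ (.svar _ _)
    (G.app (.var (.comp A :: Γ) 0 _ rfl)))) d
  simpa [G.closed] using hb

def CRetract.ofLinUnit {A' A f g} (F : CRetract A' A f g) :
    VRetract (.lin .iunit A') (.comp A) (.ofLinUnit A' f) (.toLinUnit A g) where
  map := CMap.ofLinUnit F.map
  inv := CMap.toLinUnit F.inv
  inv_map Γ := by
    have d : Deriv (.lin .iunit A' :: Γ) none (.var 0) (.lin .iunit A') := .var _ _ _ rfl
    have dt : Deriv (.lin .iunit A' :: Γ) none (.lapp (.var 0) .top) (.comp A') :=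
      .lapp _ _ _ _ _ _ d (.top _)
    refine .trans ((CMap.toLinUnit F.inv).congr (CMap.ofLinUnit_app F.map d)) ?_
    refine .trans (CMap.toLinUnit_app F.inv (F.map.app dt)) ?_
    refine .trans (.llam_cong ?_) (.llam_eta d)
    refine .trans (.ilet_cong (.refl (.svar _ _)) (F.inv_map_app dt)) ?_
    exact .ilet_eta (.svar _ _) (.lapp _ _ _ _ _ _ d (.svar _ _))

def CRetract.toLinUnit {A A' f g} (F : CRetract A A' f g) :
    VRetract (.comp A) (.lin .iunit A') (.toLinUnit A f) (.ofLinUnit A' g) where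
  map := CMap.toLinUnit F.map
  inv := CMap.ofLinUnit F.inv
  inv_map Γ := by
    have d : Deriv (.comp A :: Γ) none (.var 0) (.comp A) := .var _ _ _ rfl
    have d₁ : Deriv (.comp A :: Γ) (some .iunit) (.ilet .svar (.lapp f (.var 0))) (.comp A') :=
      .ilet _ _ _ _ _ (.svar _ _) (F.map.app d)
    refine .trans ((CMap.ofLinUnit F.inv).congr (CMap.toLinUnit_app F.map d)) ?_
    refine .trans (CMap.ofLinUnit_app F.inv (.llam _ _ _ _ d₁)) ?_
    have hb := EEq.llam_beta d₁ (.top _)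
    simp [F.map.closed] at hb
    refine .trans (F.inv.congr (hb.trans (.ilet_beta (F.map.app d)))) ?_
    exact F.inv_map_app d

end

/-! ## The coercions `ι` are isomorphisms -/

/-- Mutually inverse closed terms `f : A → B` and `g : B → A`. -/
structure VIso (A B : VType) (f g : Tm) where
  left : VRetract A B f g
  right : VRetract B A g f

/-- Mutually inverse closed terms `f : A ⊸ B` and `g : B ⊸ A`. -/
structure CIso (A B : CType) (f g : Tm) where
  left : CRetract A B f g
  right : CRetract B A g f

/-- The result types `R̲` with `R̲ᶜ = I̲`. -/
def IsAnswerType (R : CType) : Prop :=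
  (∃ a : ℕ, R = CType.base a) ∨ R = CType.iunit

theorem IsAnswerType.cpsC_self {R : CType} (hR : IsAnswerType R) : cpsC R R = .iunit := by
  obtain ⟨a, rfl⟩ | rfl := hR <;> simp [cpsC]

theorem IsAnswerType.cpsC_cpsC_base {R : CType} (hR : IsAnswerType R) (a : ℕ) :
    cpsC R (cpsC R (.base a)) = .base a := by
  obtain ⟨b, rfl⟩ | rfl := hR
  · by_cases h : b = a <;> simp [cpsC, h]
  · simp [cpsC]

mutual

def iotaVIso {R : CType} (hR : IsAnswerType R) :
    ∀ A : VType, VIso (cpsV R (cpsV R A)) A (iotaV R A) (iotaVinv R A)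
  | .base a => ⟨.id _, .id _⟩
  | .unit => ⟨.unit, .unit⟩
  | .prod A B =>
      have F := iotaVIso hR A
      have H := iotaVIso hR B
      ⟨F.left.prod H.left, F.right.prod H.right⟩
  | .arr A B =>
      have F := iotaVIso hR A
      have H := iotaVIso hR B
      ⟨F.left.arr H.left, F.right.arr H.right⟩
  | .comp A =>
      have F := iotaCIso hR A
      by
        simp only [iotaV, iotaVinv, cpsV, hR.cpsC_self]
        exact ⟨F.left.ofLinUnit, F.right.toLinUnit⟩
  | .lin A B =>
      have F := iotaCIso hR A
      have H := iotaCIso hR B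
      ⟨F.left.lin H.left, F.right.lin H.right⟩

def iotaCIso {R : CType} (hR : IsAnswerType R) :
    ∀ A : CType, CIso (cpsC R (cpsC R A)) A (iotaC R A) (iotaCinv R A)
  | .base a => by
      simp only [iotaC, iotaCinv, hR.cpsC_cpsC_base]
      exact ⟨.id _, .id _⟩
  | .cunit => ⟨.cunit, .cunit⟩
  | .cand A B =>
      have F := iotaCIso hR A
      have H := iotaCIso hR B
      ⟨F.left.cand H.left, F.right.cand H.right⟩
  | .carr A B =>
      have F := iotaVIso hR A
      have H := iotaCIso hR B
      ⟨.carr F.left H.left, .carr F.right H.right⟩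
  | .iunit => by
      simp only [iotaC, iotaCinv, cpsC, hR.cpsC_self]
      exact ⟨.id _, .id _⟩
  | .bang A =>
      have F := iotaVIso hR A
      by
        simp only [iotaC, iotaCinv, cpsC, hR.cpsC_self]
        exact ⟨.ofCopowUnit F.left, .toCopowUnit F.right⟩
  | .copow A B =>
      have F := iotaVIso hR A
      have H := iotaCIso hR B
      ⟨.copow F.left H.left, .copow F.right H.right⟩
  | .czero => ⟨.id _, .id _⟩
  | .csum A B =>
      have F := iotaCIso hR A
      have H := iotaCIso hR B
      ⟨F.left.csum H.left, F.right.csum H.right⟩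

end

/-- **The double-dualisation coercions are isomorphisms** (Lemma 5.3):
suppose `R̲` is either a computation-type constant or the type `I̲`.  Then
for every value type `A` the closed term `ι_A : (Aᶜ)ᶜ → A` is an
isomorphism, i.e. there is a closed term `ι_A⁻¹ : A → (Aᶜ)ᶜ` with
`λx:A. ι_A(ι_A⁻¹ x) = λx:A. x` and `λx:(Aᶜ)ᶜ. ι_A⁻¹(ι_A x) = λx:(Aᶜ)ᶜ. x`
in the equational theory of EEC; and for every computation type `A̲` the
closed term `ι_A̲ : (A̲ᶜ)ᶜ ⊸ A̲` is a linear isomorphism. -/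
theorem iota_isomorphism (R : CType)
    (hR : (∃ a : ℕ, R = CType.base a) ∨ R = CType.iunit) :
    (∀ A : VType,
      Nonempty (Deriv [] none (iotaV R A) (.arr (cpsV R (cpsV R A)) A)) ∧
      ∃ inv : Tm,
        Nonempty (Deriv [] none inv (.arr A (cpsV R (cpsV R A)))) ∧
        EEq [] none (.vlam A (.vapp (iotaV R A) (.vapp inv (.var 0))))
          (.vlam A (.var 0)) (.arr A A) ∧
        EEq [] none
          (.vlam (cpsV R (cpsV R A)) (.vapp inv (.vapp (iotaV R A) (.var 0))))
          (.vlam (cpsV R (cpsV R A)) (.var 0))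
          (.arr (cpsV R (cpsV R A)) (cpsV R (cpsV R A)))) ∧
    (∀ A : CType,
      Nonempty (Deriv [] none (iotaC R A) (.lin (cpsC R (cpsC R A)) A)) ∧
      ∃ inv : Tm,
        Nonempty (Deriv [] none inv (.lin A (cpsC R (cpsC R A)))) ∧
        EEq [] none (.llam A (.lapp (iotaC R A) (.lapp inv .svar)))
          (.llam A .svar) (.lin A A) ∧
        EEq [] none
          (.llam (cpsC R (cpsC R A)) (.lapp inv (.lapp (iotaC R A) .svar)))
          (.llam (cpsC R (cpsC R A)) .svar)
          (.lin (cpsC R (cpsC R A)) (cpsC R (cpsC R A)))) := by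
  refine ⟨fun A => ?_, fun A => ?_⟩
  · have I := iotaVIso hR A
    exact ⟨⟨I.left.map.deriv _⟩, iotaVinv R A, ⟨I.left.inv.deriv _⟩,
      .vlam_cong (I.right.inv_map _), .vlam_cong (I.left.inv_map _)⟩
  · have I := iotaCIso hR A
    exact ⟨⟨I.left.map.deriv _⟩, iotaCinv R A, ⟨I.left.inv.deriv _⟩,
      .llam_cong (I.right.inv_map _), .llam_cong (I.left.inv_map _)⟩

end EEC
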